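/- Let u be a vanishing viscosity solution on Ω of the intrinsic minimal surface equation X(Xu/√(1+|Xu|²)) = 0, where X denotes the nonlinear vector field X_{1,u}. Then for every integer k ≥ 1 and every α ∈ (0,1) the k-th iterated derivative of u along X exists weakly and is locally α-Hölder continuous: there exist functions g₀, g₁, …, g_k : Ω → ℝ with g₀ = u such that for each 0 ≤ j < k one has ∫ g_{j+1}·φ = −∫ g_j·(Xφ + m₁·φ) for all φ ∈ C∞_c(Ω) (i.e. g_{j+1} is the weak derivative of g_j along X), and each g_j is α-Hölder continuous on every compact subset of Ω. -/

import Mathlib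

open MeasureTheory Real Filter Topology

noncomputable section

/-- Partial derivative ∂ₓ₁ on ℝ². -/
def pd1 (f : ℝ × ℝ → ℝ) (p : ℝ × ℝ) : ℝ := fderiv ℝ f p (1, 0)

/-- Partial derivative ∂ₓ₂ on ℝ². -/
def pd2 (f : ℝ × ℝ → ℝ) (p : ℝ × ℝ) : ℝ := fderiv ℝ f p (0, 1)

/-- Partial derivative ∂ₓ₃ on ℝ³ = ℝ × ℝ × ℝ. -/
def pd3 (g : ℝ × ℝ × ℝ → ℝ) (q : ℝ × ℝ × ℝ) : ℝ := fderiv ℝ g q (0, 0, 1)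

/-- Vector field a·∂ₓ₁ + b·∂ₓ₂ with coefficients evaluated along the graph of u. -/
def VF (a b : ℝ × ℝ × ℝ → ℝ) (u : ℝ × ℝ → ℝ) (f : ℝ × ℝ → ℝ) (p : ℝ × ℝ) : ℝ :=
  a (p.1, p.2, u p) * pd1 f p + b (p.1, p.2, u p) * pd2 f p

/-- The nonlinear vector field X₁ = X_{1,u}. -/
def X1 (s11 s12 : ℝ × ℝ × ℝ → ℝ) (u : ℝ × ℝ → ℝ) : (ℝ × ℝ → ℝ) → ℝ × ℝ → ℝ :=
  VF s11 s12 u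

/-- The transverse vector field Y = X₂/ε (coefficients σ₂ʲ = ∂ₓ₃σ₁ʲ). -/
def Yf (s11 s12 : ℝ × ℝ × ℝ → ℝ) (u : ℝ × ℝ → ℝ) : (ℝ × ℝ → ℝ) → ℝ × ℝ → ℝ :=
  VF (pd3 s11) (pd3 s12) u

/-- The scaled vector field X₂ = ε·Y. -/
def X2 (s11 s12 : ℝ × ℝ × ℝ → ℝ) (ε : ℝ) (u : ℝ × ℝ → ℝ) (f : ℝ × ℝ → ℝ) (p : ℝ × ℝ) : ℝ :=
  ε * Yf s11 s12 u f p

/-- The pair (X₁, X₂) of vector fields. -/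
def XX (s11 s12 : ℝ × ℝ × ℝ → ℝ) (ε : ℝ) (u : ℝ × ℝ → ℝ) :
    Fin 2 → (ℝ × ℝ → ℝ) → ℝ × ℝ → ℝ :=
  ![X1 s11 s12 u, X2 s11 s12 ε u]

/-- |∇ε f| = |(X₁f, X₂f)|. -/
def gradN (s11 s12 : ℝ × ℝ × ℝ → ℝ) (ε : ℝ) (u f : ℝ × ℝ → ℝ) (p : ℝ × ℝ) : ℝ :=
  Real.sqrt ((X1 s11 s12 u f p) ^ 2 + (X2 s11 s12 ε u f p) ^ 2)

/-- The weight √(1+|∇εu|²). -/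
def Wt (s11 s12 : ℝ × ℝ × ℝ → ℝ) (ε : ℝ) (u : ℝ × ℝ → ℝ) (p : ℝ × ℝ) : ℝ :=
  Real.sqrt (1 + (gradN s11 s12 ε u u p) ^ 2)

/-- The regularized minimal surface operator L_{ε,u}u = Σᵢ Xᵢ(Xᵢu/√(1+|∇εu|²)). -/
def Lop (s11 s12 : ℝ × ℝ × ℝ → ℝ) (ε : ℝ) (u : ℝ × ℝ → ℝ) (p : ℝ × ℝ) : ℝ :=
  X1 s11 s12 u (fun q => X1 s11 s12 u u q / Wt s11 s12 ε u q) p +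
  X2 s11 s12 ε u (fun q => X2 s11 s12 ε u u q / Wt s11 s12 ε u q) p

/-- The coefficients a_{ij}(∇εu) = δ_{ij} − (Xᵢu)(Xⱼu)/(1+|∇εu|²). -/
def aC (s11 s12 : ℝ × ℝ × ℝ → ℝ) (ε : ℝ) (u : ℝ × ℝ → ℝ) (i j : Fin 2) (p : ℝ × ℝ) : ℝ :=
  (if i = j then 1 else 0) -
    XX s11 s12 ε u i u p * XX s11 s12 ε u j u p / (1 + (gradN s11 s12 ε u u p) ^ 2)

/-- The coefficients 𝒜_{ij} = a_{ij}(∇εu)/√(1+|∇εu|²). -/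
def AC (s11 s12 : ℝ × ℝ × ℝ → ℝ) (ε : ℝ) (u : ℝ × ℝ → ℝ) (i j : Fin 2) (p : ℝ × ℝ) : ℝ :=
  aC s11 s12 ε u i j p / Wt s11 s12 ε u p

/-- The linearized divergence–form operator M_{ε,u}z = Σ_{i,j} Xᵢ(𝒜_{ij}·Xⱼz). -/
def Mop (s11 s12 : ℝ × ℝ × ℝ → ℝ) (ε : ℝ) (u z : ℝ × ℝ → ℝ) (p : ℝ × ℝ) : ℝ :=
  ∑ i : Fin 2, ∑ j : Fin 2,
    XX s11 s12 ε u i (fun q => AC s11 s12 ε u i j q * XX s11 s12 ε u j z q) p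

/-- Iterated derivatives X_{i₁}⋯X_{i_k} z. -/
def iterX (s11 s12 : ℝ × ℝ × ℝ → ℝ) (ε : ℝ) (u : ℝ × ℝ → ℝ) :
    (k : ℕ) → (Fin k → Fin 2) → (ℝ × ℝ → ℝ) → ℝ × ℝ → ℝ
  | 0, _, z => z
  | k + 1, I, z => XX s11 s12 ε u (I 0) (iterX s11 s12 ε u k (fun j => I j.succ) z)

/-- |∇εᵏ z| : Euclidean norm of the vector of all k-fold iterated derivatives. -/
def gradkN (s11 s12 : ℝ × ℝ × ℝ → ℝ) (ε : ℝ) (u : ℝ × ℝ → ℝ) (k : ℕ) (z : ℝ × ℝ → ℝ)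
    (p : ℝ × ℝ) : ℝ :=
  Real.sqrt (∑ I : Fin k → Fin 2, (iterX s11 s12 ε u k I z p) ^ 2)

/-- Lᵖ norm over K. -/
def LpN (q : ℝ) (f : ℝ × ℝ → ℝ) (K : Set (ℝ × ℝ)) : ℝ :=
  (∫ p in K, |f p| ^ q) ^ (1 / q)

/-- Sobolev norm ‖z‖_{Wε^{m,q}(K)} = Σ_{k=0}^m ‖|∇εᵏz|‖_{Lᵠ(K)}. -/
def WN (s11 s12 : ℝ × ℝ × ℝ → ℝ) (ε : ℝ) (u : ℝ × ℝ → ℝ) (m : ℕ) (q : ℝ)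
    (z : ℝ × ℝ → ℝ) (K : Set (ℝ × ℝ)) : ℝ :=
  ∑ k ∈ Finset.range (m + 1), LpN q (gradkN s11 s12 ε u k z) K

/-- m₁ = ∂ₓ₁[σ₁¹(·,u)] + ∂ₓ₂[σ₁²(·,u)]. -/
def m1 (s11 s12 : ℝ × ℝ × ℝ → ℝ) (u : ℝ × ℝ → ℝ) (p : ℝ × ℝ) : ℝ :=
  pd1 (fun q => s11 (q.1, q.2, u q)) p + pd2 (fun q => s12 (q.1, q.2, u q)) p

/-- Euclidean gradient length |∇_E f|. -/
def egN (f : ℝ × ℝ → ℝ) (p : ℝ × ℝ) : ℝ :=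
  Real.sqrt ((pd1 f p) ^ 2 + (pd2 f p) ^ 2)

/-- A cutoff function in Ω: smooth, compactly supported in Ω, 0 ≤ φ ≤ 1. -/
def IsCutoff (Ω : Set (ℝ × ℝ)) (φ : ℝ × ℝ → ℝ) : Prop :=
  ContDiff ℝ (⊤ : ℕ∞) φ ∧ HasCompactSupport φ ∧ tsupport φ ⊆ Ω ∧ ∀ p, 0 ≤ φ p ∧ φ p ≤ 1

/-- A test function φ ∈ C∞_c(Ω). -/
def IsTest (Ω : Set (ℝ × ℝ)) (φ : ℝ × ℝ → ℝ) : Prop :=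
  ContDiff ℝ (⊤ : ℕ∞) φ ∧ HasCompactSupport φ ∧ tsupport φ ⊆ Ω

/-- The Lipschitz bound ‖X₁u‖_{L∞(Ω)} + ‖Yu‖_{L∞(Ω)} ≤ M. -/
def LipBound (s11 s12 : ℝ × ℝ × ℝ → ℝ) (Ω : Set (ℝ × ℝ)) (u : ℝ × ℝ → ℝ) (M : ℝ) : Prop :=
  ∀ p ∈ Ω, |X1 s11 s12 u u p| + |Yf s11 s12 u u p| ≤ M

/-- Rank condition |σ₁¹·∂ₓ₃σ₁² − σ₁²·∂ₓ₃σ₁¹| > 0. -/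
def RankCond (s11 s12 : ℝ × ℝ × ℝ → ℝ) : Prop :=
  ∀ q : ℝ × ℝ × ℝ, 0 < |s11 q * pd3 s12 q - s12 q * pd3 s11 q|

/-- Vanishing viscosity solution of the intrinsic minimal surface equation. -/
def IsVVSol (s11 s12 : ℝ × ℝ × ℝ → ℝ) (Ω : Set (ℝ × ℝ)) (u : ℝ × ℝ → ℝ) : Prop :=
  ∃ (εs : ℕ → ℝ) (us : ℕ → ℝ × ℝ → ℝ) (l : NNReal),
    (∀ n, 0 < εs n ∧ εs n ≤ 1) ∧ Tendsto εs atTop (𝓝 0) ∧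
    (∀ n, ContDiff ℝ (⊤ : ℕ∞) (us n)) ∧
    (∀ n, ∀ p ∈ Ω, Lop s11 s12 (εs n) (us n) p = 0) ∧
    (∀ n, LipschitzOnWith l (us n) Ω) ∧ (∀ n, ∀ p ∈ Ω, |us n p| ≤ l) ∧
    (∀ K ⊆ Ω, IsCompact K → TendstoUniformlyOn us u atTop K)

/-- The antisymmetric commutator coefficients ω^l_{j,k} with ω^l_{1,2} = ω^l. -/
def wAnti (ω : Fin 2 → ℝ × ℝ → ℝ) (l j k : Fin 2) (p : ℝ × ℝ) : ℝ :=
  if j = k then 0 else if j = 0 then ω l p else -(ω l p)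

/-- Euclidean Hölder class C^{1,α} on Ω. -/
def EuclC1Alpha (Ω : Set (ℝ × ℝ)) (α : ℝ) (h : ℝ × ℝ → ℝ) : Prop :=
  Differentiable ℝ h ∧
    ∃ H : ℝ, ∀ p ∈ Ω, ∀ q ∈ Ω, ‖fderiv ℝ h p - fderiv ℝ h q‖ ≤ H * dist p q ^ α

/-- Frozen first-order intrinsic Taylor polynomial P_{x₀}h. -/
def Pfroz (s11 s12 : ℝ × ℝ × ℝ → ℝ) (ε : ℝ) (u h : ℝ × ℝ → ℝ) (x0 x : ℝ × ℝ) : ℝ :=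
  h x0 +
    ((pd3 s12 (x0.1, x0.2, u x0) /
        (s11 (x0.1, x0.2, u x0) * pd3 s12 (x0.1, x0.2, u x0) -
          s12 (x0.1, x0.2, u x0) * pd3 s11 (x0.1, x0.2, u x0))) * (x - x0).1 -
      (pd3 s11 (x0.1, x0.2, u x0) /
        (s11 (x0.1, x0.2, u x0) * pd3 s12 (x0.1, x0.2, u x0) -
          s12 (x0.1, x0.2, u x0) * pd3 s11 (x0.1, x0.2, u x0))) * (x - x0).2) *
      X1 s11 s12 u h x0 +
    ((1 / ε) *
      ((s11 (x0.1, x0.2, u x0) /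
          (s11 (x0.1, x0.2, u x0) * pd3 s12 (x0.1, x0.2, u x0) -
            s12 (x0.1, x0.2, u x0) * pd3 s11 (x0.1, x0.2, u x0))) * (x - x0).2 -
        (s12 (x0.1, x0.2, u x0) /
          (s11 (x0.1, x0.2, u x0) * pd3 s12 (x0.1, x0.2, u x0) -
            s12 (x0.1, x0.2, u x0) * pd3 s11 (x0.1, x0.2, u x0))) * (x - x0).1)) *
      X2 s11 s12 ε u h x0


/-- Directional derivative. -/
def pdv (e : ℝ × ℝ) (f : ℝ × ℝ → ℝ) (p : ℝ × ℝ) : ℝ := fderiv ℝ f p e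

lemma lip_of_compact {Ω : Set (ℝ × ℝ)} (hΩ : IsOpen Ω) {w : ℝ × ℝ → ℝ}
    (hw : LocallyLipschitzOn Ω w) (hc : HasCompactSupport w) (ht : tsupport w ⊆ Ω) :
    ∃ C, LipschitzWith C w := by
  have hloc : LocallyLipschitz w := by
    intro x
    by_cases hx : x ∈ Ω
    · obtain ⟨K, t, htt, hK⟩ := hw hx
      refine ⟨K, t, ?_, hK⟩
      rwa [hΩ.nhdsWithin_eq hx] at htt
    · have hx' : x ∈ (tsupport w)ᶜ := fun h => hx (ht h)
      refine ⟨0, (tsupport w)ᶜ, (isClosed_tsupport w).isOpen_compl.mem_nhds hx', ?_⟩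
      intro a ha b hb
      rw [image_eq_zero_of_notMem_tsupport ha, image_eq_zero_of_notMem_tsupport hb]
      simp
  obtain ⟨R, hR⟩ := hc.isCompact.isBounded.subset_closedBall 0
  obtain ⟨M, hM⟩ := hc.isCompact.exists_bound_of_continuousOn (f := w)
    hloc.continuous.continuousOn
  obtain ⟨K, hK⟩ := (hloc.locallyLipschitzOn
    (s := Metric.closedBall 0 (R + 1))).exists_lipschitzOnWith_of_compact
      (isCompact_closedBall _ _)
  have key : ∀ x y, x ∈ Metric.closedBall (0 : ℝ × ℝ) (R + 1) → y ∉ Metric.closedBall (0 : ℝ × ℝ) (R + 1) →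
      dist (w x) (w y) ≤ |M| * dist x y := by
    intro x y hx hy
    have hy0 : w y = 0 := by
      apply image_eq_zero_of_notMem_tsupport
      intro h; exact hy (Metric.closedBall_subset_closedBall (by linarith) (hR h))
    by_cases hxs : x ∈ tsupport w
    · have h1 := hR hxs
      rw [mem_closedBall_zero_iff] at h1
      rw [mem_closedBall_zero_iff, not_le] at hy
      have h2 : 1 ≤ dist x y := by
        rw [dist_comm, dist_eq_norm]
        have := norm_sub_norm_le y x
        linarith
      rw [hy0, dist_zero_right]
      calc ‖w x‖ ≤ M := hM x hxs
        _ ≤ |M| * 1 := by rw [mul_one]; exact le_abs_self M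
        _ ≤ |M| * dist x y := by gcongr
    · rw [hy0, image_eq_zero_of_notMem_tsupport hxs, dist_self]; positivity
  refine ⟨K + ‖M‖₊, LipschitzWith.of_dist_le_mul fun x y => ?_⟩
  have hcoe : ((K + ‖M‖₊ : NNReal) : ℝ) = K + |M| := by simp
  rw [hcoe]
  have hd : 0 ≤ dist x y := dist_nonneg
  have e1 : |M| * dist x y ≤ (K + |M|) * dist x y := by
    gcongr; simp
  have e2 : K * dist x y ≤ (K + |M|) * dist x y := by
    gcongr; simp
  by_cases hx : x ∈ Metric.closedBall (0 : ℝ × ℝ) (R + 1) <;>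
    by_cases hy : y ∈ Metric.closedBall (0 : ℝ × ℝ) (R + 1)
  · exact (hK.dist_le_mul x hx y hy).trans e2
  · exact (key x y hx hy).trans e1
  · rw [dist_comm (w x), dist_comm x]
    rw [dist_comm x] at e1
    exact (key y x hy hx).trans e1
  · have : ∀ z, z ∉ Metric.closedBall (0 : ℝ × ℝ) (R + 1) → w z = 0 := by
      intro z hz
      apply image_eq_zero_of_notMem_tsupport
      intro h; exact hz (Metric.closedBall_subset_closedBall (by linarith) (hR h))
    rw [this x hx, this y hy, dist_self]; positivity

lemma int_pdv_zero_glob {C : NNReal} {w : ℝ × ℝ → ℝ} (hw : LipschitzWith C w)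
    (hc : HasCompactSupport w) (e : ℝ × ℝ) : ∫ p, pdv e w p = 0 := by
  have h := LipschitzWith.integral_lineDeriv_mul_eq (μ := volume)
    (LipschitzWith.const (1 : ℝ)) hw hc (-e)
  have h0 : ∀ x : ℝ × ℝ, lineDeriv ℝ (fun _ : ℝ × ℝ => (1 : ℝ)) x (-e) = 0 := by
    intro x; simp [lineDeriv]
  simp only [h0, zero_mul, integral_zero, neg_neg, mul_one] at h
  rw [h]
  apply integral_congr_ae
  filter_upwards [hw.ae_differentiableAt] with p hp
  rw [hp.lineDeriv_eq_fderiv]; rfl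

lemma pdv_zero_of_notMem {w : ℝ × ℝ → ℝ} {p e : ℝ × ℝ} (h : p ∉ tsupport w) : pdv e w p = 0 := by
  have : fderiv ℝ w p = 0 := by
    have := support_fderiv_subset ℝ (f := w)
    by_contra hne
    exact h (this hne)
  simp [pdv, this]

lemma int_pdv_zero {Ω : Set (ℝ × ℝ)} (hΩ : IsOpen Ω) {w : ℝ × ℝ → ℝ}
    (hw : LocallyLipschitzOn Ω w) (hc : HasCompactSupport w) (ht : tsupport w ⊆ Ω) (e : ℝ × ℝ) :
    ∫ p in Ω, pdv e w p = 0 := by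
  obtain ⟨C, hC⟩ := lip_of_compact hΩ hw hc ht
  rw [setIntegral_eq_integral_of_forall_compl_eq_zero, int_pdv_zero_glob hC hc]
  intro x hx
  exact pdv_zero_of_notMem fun h => hx (ht h)

lemma pdv_bound {Ω : Set (ℝ × ℝ)} (hΩ : IsOpen Ω) {f : ℝ × ℝ → ℝ} {C : NNReal}
    (hf : LipschitzOnWith C f Ω) {p e : ℝ × ℝ} (hp : p ∈ Ω) (he : ‖e‖ ≤ 1) : |pdv e f p| ≤ C := by
  have h := norm_fderiv_le_of_lipschitzOn ℝ (hΩ.mem_nhds hp) hf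
  calc |pdv e f p| ≤ ‖fderiv ℝ f p‖ * ‖e‖ := (fderiv ℝ f p).le_opNorm e
    _ ≤ C * 1 := by gcongr
    _ = C := mul_one _

lemma pdv_meas (e : ℝ × ℝ) (f : ℝ × ℝ → ℝ) : Measurable (pdv e f) :=
  measurable_fderiv_apply_const ℝ f e

lemma ae_diff {Ω : Set (ℝ × ℝ)} (hΩ : IsOpen Ω) {f : ℝ × ℝ → ℝ}
    (hf : LocallyLipschitzOn Ω f) : ∀ᵐ p ∂(volume.restrict Ω), DifferentiableAt ℝ f p := by
  rw [ae_restrict_iff' hΩ.measurableSet]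
  have : volume {p | p ∈ Ω ∧ ¬ DifferentiableAt ℝ f p} = 0 := by
    apply measure_null_of_locally_null
    rintro x ⟨hx, -⟩
    obtain ⟨K, t, ht, hK⟩ := hf hx
    rw [hΩ.nhdsWithin_eq hx] at ht
    have h1 := hK.ae_differentiableWithinAt_of_mem (μ := volume)
    refine ⟨interior t ∩ {p | p ∈ Ω ∧ ¬ DifferentiableAt ℝ f p}, ?_, ?_⟩
    · rw [Set.inter_comm]
      exact inter_mem_nhdsWithin _ (interior_mem_nhds.2 ht)
    · refine measure_mono_null ?_ (ae_iff.1 h1)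
      rintro y ⟨hy, _, hy2⟩ hcon
      exact hy2 ((hcon (interior_subset hy)).differentiableAt (mem_interior_iff_mem_nhds.1 hy))
  rw [ae_iff]
  convert this using 2
  ext p; simp

lemma pdv_mul {e : ℝ × ℝ} {f g : ℝ × ℝ → ℝ} {p : ℝ × ℝ} (hf : DifferentiableAt ℝ f p)
    (hg : DifferentiableAt ℝ g p) :
    pdv e (fun q => f q * g q) p = pdv e f p * g p + f p * pdv e g p := by
  simp only [pdv]
  rw [fderiv_fun_mul hf hg]
  simp; ring

lemma pdv_add {e : ℝ × ℝ} {f g : ℝ × ℝ → ℝ} {p : ℝ × ℝ} (hf : DifferentiableAt ℝ f p)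
    (hg : DifferentiableAt ℝ g p) :
    pdv e (fun q => f q + g q) p = pdv e f p + pdv e g p := by
  simp only [pdv]
  rw [fderiv_fun_add hf hg]
  simp

lemma pdv_sub {e : ℝ × ℝ} {f g : ℝ × ℝ → ℝ} {p : ℝ × ℝ} (hf : DifferentiableAt ℝ f p)
    (hg : DifferentiableAt ℝ g p) :
    pdv e (fun q => f q - g q) p = pdv e f p - pdv e g p := by
  simp only [pdv]
  rw [fderiv_fun_sub hf hg]
  simp

lemma locLip_mul {Ω : Set (ℝ × ℝ)} {f g : ℝ × ℝ → ℝ} (hf : LocallyLipschitzOn Ω f)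
    (hg : LocallyLipschitzOn Ω g) : LocallyLipschitzOn Ω (fun q => f q * g q) := by
  have h : LocallyLipschitz (fun z : ℝ × ℝ => z.1 * z.2) :=
    ContDiff.locallyLipschitz (𝕂 := ℝ) (by fun_prop)
  intro x hx
  obtain ⟨K, t, ht, hK⟩ := hf hx
  obtain ⟨K2, t2, ht2, hK2⟩ := hg hx
  obtain ⟨K3, t3, ht3, hK3⟩ := h (f x, g x)
  have hcf : ContinuousWithinAt (fun q => (f q, g q)) Ω x :=
    (hf.continuousOn x hx).prodMk (hg.continuousOn x hx)
  refine ⟨K3 * max K K2, t ∩ t2 ∩ (fun q => (f q, g q)) ⁻¹' t3,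
    inter_mem (inter_mem ht ht2) (hcf ht3), ?_⟩
  have := hK3.comp (s := t ∩ t2 ∩ (fun q => (f q, g q)) ⁻¹' t3) (f := fun q => (f q, g q))
    ((hK.mono (fun z hz => hz.1.1)).prodMk (hK2.mono (fun z hz => hz.1.2))) (fun z hz => hz.2)
  exact this

lemma locLip_sub {Ω : Set (ℝ × ℝ)} {f g : ℝ × ℝ → ℝ} (hf : LocallyLipschitzOn Ω f)
    (hg : LocallyLipschitzOn Ω g) : LocallyLipschitzOn Ω (fun q => f q - g q) := by
  intro x hx
  obtain ⟨K, t, ht, hK⟩ := hf hx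
  obtain ⟨K2, t2, ht2, hK2⟩ := hg hx
  refine ⟨K + K2, t ∩ t2, inter_mem ht ht2, ?_⟩
  exact (hK.mono Set.inter_subset_left).sub (hK2.mono Set.inter_subset_right)

lemma lipOn_locLip {Ω : Set (ℝ × ℝ)} {f : ℝ × ℝ → ℝ} {C : NNReal} (hf : LipschitzOnWith C f Ω) :
    LocallyLipschitzOn Ω f := fun x _ => ⟨C, Ω, self_mem_nhdsWithin, hf⟩

lemma smooth_locLip {Ω : Set (ℝ × ℝ)} {f : ℝ × ℝ → ℝ} (hf : ContDiff ℝ (⊤ : ℕ∞) f) :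
    LocallyLipschitzOn Ω f :=
  (ContDiff.locallyLipschitz (𝕂 := ℝ) (hf.of_le (by exact_mod_cast le_top))).locallyLipschitzOn

/-- bounded-measurable implies integrable on a bounded set. -/
lemma integ_of_bdd {Ω : Set (ℝ × ℝ)} (hΩ : IsOpen Ω) (hb : Bornology.IsBounded Ω)
    {f : ℝ × ℝ → ℝ} (hf : AEStronglyMeasurable f (volume.restrict Ω)) (M : ℝ)
    (hM : ∀ p ∈ Ω, |f p| ≤ M) : Integrable f (volume.restrict Ω) := by
  have : IsFiniteMeasure (volume.restrict Ω) := ⟨by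
    rw [Measure.restrict_apply_univ]; exact hb.measure_lt_top⟩
  refine Integrable.of_bound hf M ?_
  rw [ae_restrict_iff' hΩ.measurableSet]
  exact Eventually.of_forall hM

lemma dct {Ω : Set (ℝ × ℝ)} (hΩ : IsOpen Ω) (hb : Bornology.IsBounded Ω)
    {F : ℕ → ℝ × ℝ → ℝ} {f : ℝ × ℝ → ℝ}
    (hF : ∀ n, AEStronglyMeasurable (F n) (volume.restrict Ω)) (M : ℝ)
    (hM : ∀ n, ∀ p ∈ Ω, |F n p| ≤ M)
    (hl : ∀ p ∈ Ω, Tendsto (fun n => F n p) atTop (𝓝 (f p))) :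
    Tendsto (fun n => ∫ p in Ω, F n p) atTop (𝓝 (∫ p in Ω, f p)) := by
  have : IsFiniteMeasure (volume.restrict Ω) := ⟨by
    rw [Measure.restrict_apply_univ]; exact hb.measure_lt_top⟩
  refine tendsto_integral_of_dominated_convergence (fun _ => M) hF (integrable_const _) ?_ ?_
  · intro n
    rw [ae_restrict_iff' hΩ.measurableSet]
    exact Eventually.of_forall (hM n)
  · rw [ae_restrict_iff' hΩ.measurableSet]
    exact Eventually.of_forall hl

lemma test_bdd {χ : ℝ × ℝ → ℝ} (h : Continuous χ) (hc : HasCompactSupport χ) :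
    ∃ A : ℝ, 0 ≤ A ∧ ∀ p, |χ p| ≤ A := by
  obtain ⟨A, hA⟩ := hc.exists_bound_of_continuous h
  exact ⟨A, (norm_nonneg _).trans (hA 0), hA⟩

lemma test_pdv {χ : ℝ × ℝ → ℝ} (h : ContDiff ℝ (⊤ : ℕ∞) χ) (hc : HasCompactSupport χ) (e : ℝ × ℝ) :
    Continuous (pdv e χ) ∧ ∃ A : ℝ, 0 ≤ A ∧ ∀ p, |pdv e χ p| ≤ A := by
  have hcont : Continuous (pdv e χ) :=
    (h.continuous_fderiv (by simp)).clm_apply continuous_const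
  refine ⟨hcont, test_bdd hcont ?_⟩
  exact hc.fderiv_apply (𝕜 := ℝ) (v := e)

lemma tendsto_of_approx {a : ℕ → ℝ} {l : ℝ}
    (h : ∀ η > 0, ∃ b : ℕ → ℝ, ∃ m : ℝ, Tendsto b atTop (𝓝 m) ∧ (∀ n, |a n - b n| ≤ η) ∧ |l - m| ≤ η) :
    Tendsto a atTop (𝓝 l) := by
  rw [Metric.tendsto_atTop]
  intro ε hε
  obtain ⟨b, m, hb, h1, h2⟩ := h (ε / 4) (by positivity)
  rw [Metric.tendsto_atTop] at hb
  obtain ⟨N, hN⟩ := hb (ε / 4) (by positivity)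
  refine ⟨N, fun n hn => ?_⟩
  have h3 := hN n hn
  rw [Real.dist_eq] at h3 ⊢
  have h4 := h1 n
  have e : a n - l = (a n - b n) + (b n - m) - (l - m) := by ring
  rw [e]
  calc _ ≤ |a n - b n| + |b n - m| + |l - m| := by
        refine (abs_sub _ _).trans ?_
        gcongr; exact abs_add_le _ _
    _ < ε := by linarith

lemma cs_mul {χ ψ : ℝ × ℝ → ℝ} (hc : HasCompactSupport χ) :
    HasCompactSupport (fun q => χ q * ψ q) := hc.mul_right

lemma ts_mul {Ω : Set (ℝ × ℝ)} {χ ψ : ℝ × ℝ → ℝ} (hc : tsupport χ ⊆ Ω) :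
    tsupport (fun q => χ q * ψ q) ⊆ Ω := (tsupport_mul_subset_left).trans hc

/-- integration by parts -/
lemma ibp {Ω : Set (ℝ × ℝ)} (hΩ : IsOpen Ω) (hb : Bornology.IsBounded Ω)
    {θ f : ℝ × ℝ → ℝ} (hθ : IsTest Ω θ) {C : NNReal} (hf : LipschitzOnWith C f Ω) {M : ℝ}
    (hM : ∀ p ∈ Ω, |f p| ≤ M) {e : ℝ × ℝ} (he : ‖e‖ ≤ 1) :
    ∫ p in Ω, θ p * pdv e f p = - ∫ p in Ω, pdv e θ p * f p := by
  obtain ⟨h1, h2, h3⟩ := hθ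
  have h := int_pdv_zero hΩ (locLip_mul (smooth_locLip h1) (lipOn_locLip hf)) (cs_mul h2)
    (ts_mul h3) e
  obtain ⟨A, hA0, hA⟩ := test_bdd h1.continuous h2
  obtain ⟨hc, A', hA'0, hA'⟩ := test_pdv h1 h2 e
  have hfm : AEStronglyMeasurable f (volume.restrict Ω) :=
    hf.continuousOn.aestronglyMeasurable hΩ.measurableSet
  have i1 : Integrable (fun p => θ p * pdv e f p) (volume.restrict Ω) := by
    refine integ_of_bdd hΩ hb ?_ (A * C) ?_
    · exact h1.continuous.aestronglyMeasurable.mul (pdv_meas e f).aestronglyMeasurable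
    · intro p hp
      rw [abs_mul]
      exact mul_le_mul (hA p) (pdv_bound hΩ hf hp he) (abs_nonneg _) hA0
  have i2 : Integrable (fun p => pdv e θ p * f p) (volume.restrict Ω) := by
    refine integ_of_bdd hΩ hb ?_ (A' * M) ?_
    · exact hc.aestronglyMeasurable.mul hfm
    · intro p hp
      rw [abs_mul]
      exact mul_le_mul (hA' p) (hM p hp) (abs_nonneg _) hA'0
  have : ∫ p in Ω, (pdv e θ p * f p + θ p * pdv e f p) = 0 := by
    rw [← h]
    apply integral_congr_ae
    filter_upwards [ae_diff hΩ (lipOn_locLip hf)] with p hp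
    rw [pdv_mul (h1.differentiable (by simp) p) hp]
  rw [integral_add i2 i1] at this
  linarith

lemma weakconv {Ω : Set (ℝ × ℝ)} (hΩ : IsOpen Ω) (hb : Bornology.IsBounded Ω)
    {χ ρ f : ℝ × ℝ → ℝ} {fs : ℕ → ℝ × ℝ → ℝ} (hχ : IsTest Ω χ) {C : NNReal} {M : ℝ}
    (hf : LipschitzOnWith C f Ω) (hM : ∀ p ∈ Ω, |f p| ≤ M)
    (hfs : ∀ n, LipschitzOnWith C (fs n) Ω) (hMs : ∀ n, ∀ p ∈ Ω, |fs n p| ≤ M)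
    (hl : ∀ p ∈ Ω, Tendsto (fun n => fs n p) atTop (𝓝 (f p)))
    (hρ : Integrable ρ (volume.restrict Ω))
    {e : ℝ × ℝ} (he : ‖e‖ ≤ 1) :
    Tendsto (fun n => ∫ p in Ω, χ p * (ρ p * pdv e (fs n) p)) atTop
      (𝓝 (∫ p in Ω, χ p * (ρ p * pdv e f p))) := by
  obtain ⟨h1, h2, h3⟩ := id hχ
  obtain ⟨A, hA0, hA⟩ := test_bdd h1.continuous h2
  apply tendsto_of_approx
  intro η hη
  obtain ⟨ψ, hψc, hψ, hψa⟩ := (memLp_one_iff_integrable.2 hρ).exist_eLpNorm_sub_le (by simp) le_rfl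
    (ε := η / (A * C + 1)) (by positivity)
  have hψi : Integrable ψ (volume.restrict Ω) :=
    (hψ.continuous.integrable_of_hasCompactSupport hψc).restrict
  have hdi : Integrable (fun p => ρ p - ψ p) (volume.restrict Ω) := hρ.sub hψi
  have hψ1 : ∫ p in Ω, |ρ p - ψ p| ≤ η / (A * C + 1) := by
    have := integral_norm_eq_lintegral_enorm hdi.1
    simp only [Real.norm_eq_abs] at this
    rw [this]
    apply ENNReal.toReal_le_of_le_ofReal (by positivity)
    rw [eLpNorm_one_eq_lintegral_enorm] at hψa
    exact hψa
  have bound : ∀ g : ℝ × ℝ → ℝ, LipschitzOnWith C g Ω →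
      |(∫ p in Ω, χ p * (ρ p * pdv e g p)) - ∫ p in Ω, χ p * ψ p * pdv e g p| ≤ η := by
    intro g hg
    have i1 : ∀ σ : ℝ × ℝ → ℝ, Integrable σ (volume.restrict Ω) →
        Integrable (fun p => χ p * pdv e g p * σ p) (volume.restrict Ω) := by
      intro σ hσ
      refine hσ.bdd_mul (c := A * C) ?_ ?_
      · exact h1.continuous.aestronglyMeasurable.mul (pdv_meas e g).aestronglyMeasurable
      · rw [ae_restrict_iff' hΩ.measurableSet]
        refine Eventually.of_forall fun p hp => ?_
        rw [Real.norm_eq_abs, abs_mul]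
        exact mul_le_mul (hA p) (pdv_bound hΩ hg hp he) (abs_nonneg _) hA0
    have e1 : (∫ p in Ω, χ p * (ρ p * pdv e g p)) - ∫ p in Ω, χ p * ψ p * pdv e g p
        = ∫ p in Ω, χ p * pdv e g p * (ρ p - ψ p) := by
      rw [← integral_sub]
      · congr 1; ext p; ring
      · refine (i1 ρ hρ).congr (Eventually.of_forall fun p => ?_); simp only; ring
      · refine (i1 ψ hψi).congr (Eventually.of_forall fun p => ?_); simp only; ring
    rw [e1]
    calc |∫ p in Ω, χ p * pdv e g p * (ρ p - ψ p)|
        ≤ ∫ p in Ω, |χ p * pdv e g p * (ρ p - ψ p)| := abs_integral_le_integral_abs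
      _ ≤ ∫ p in Ω, A * C * |ρ p - ψ p| := by
          refine setIntegral_mono_on (i1 _ hdi).abs (hdi.abs.const_mul _) hΩ.measurableSet ?_
          intro p hp
          rw [abs_mul, abs_mul]
          gcongr
          · exact hA p
          · exact pdv_bound hΩ hg hp he
      _ = A * C * ∫ p in Ω, |ρ p - ψ p| := integral_const_mul _ _
      _ ≤ A * C * (η / (A * C + 1)) := by gcongr
      _ ≤ η := by
          have : 0 ≤ A * C := by positivity
          rw [← mul_div_assoc, div_le_iff₀ (by positivity)]
          nlinarith
  have hθ : IsTest Ω (fun q => χ q * ψ q) := ⟨h1.mul hψ, cs_mul h2, ts_mul h3⟩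
  refine ⟨fun n => ∫ p in Ω, χ p * ψ p * pdv e (fs n) p, ∫ p in Ω, χ p * ψ p * pdv e f p, ?_,
    fun n => bound _ (hfs n), bound _ hf⟩
  rw [ibp hΩ hb hθ hf hM he]
  have : (fun n => ∫ p in Ω, χ p * ψ p * pdv e (fs n) p) =
      fun n => - ∫ p in Ω, pdv e (fun q => χ q * ψ q) p * fs n p := by
    ext n; exact ibp hΩ hb hθ (hfs n) (hMs n) he
  rw [this]
  apply Tendsto.neg
  obtain ⟨hc, A', hA'0, hA'⟩ := test_pdv hθ.1 hθ.2.1 e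
  refine dct hΩ hb ?_ (A' * M) ?_ ?_
  · intro n
    exact hc.aestronglyMeasurable.mul ((hfs n).continuousOn.aestronglyMeasurable hΩ.measurableSet)
  · intro n p hp
    rw [abs_mul]
    exact mul_le_mul (hA' p) (hMs n p hp) (abs_nonneg _) hA'0
  · intro p hp
    exact (hl p hp).const_mul _

lemma locLip_add {Ω : Set (ℝ × ℝ)} {f g : ℝ × ℝ → ℝ} (hf : LocallyLipschitzOn Ω f)
    (hg : LocallyLipschitzOn Ω g) : LocallyLipschitzOn Ω (fun q => f q + g q) := by
  intro x hx
  obtain ⟨K, t, ht, hK⟩ := hf hx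
  obtain ⟨K2, t2, ht2, hK2⟩ := hg hx
  refine ⟨K + K2, t ∩ t2, inter_mem ht ht2, ?_⟩
  exact (hK.mono Set.inter_subset_left).add (hK2.mono Set.inter_subset_right)

lemma integ_pdv {Ω : Set (ℝ × ℝ)} (hΩ : IsOpen Ω) (hb : Bornology.IsBounded Ω) {w : ℝ × ℝ → ℝ}
    (hw : LocallyLipschitzOn Ω w) (hc : HasCompactSupport w) (ht : tsupport w ⊆ Ω) {e : ℝ × ℝ}
    (he : ‖e‖ ≤ 1) :
    Integrable (pdv e w) (volume.restrict Ω) := by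
  obtain ⟨C, hC⟩ := lip_of_compact hΩ hw hc ht
  exact integ_of_bdd hΩ hb (pdv_meas e w).aestronglyMeasurable C
    fun p hp => pdv_bound hΩ (hC.lipschitzOnWith (s := Ω)) hp he

lemma ne1 : ‖((1, 0) : ℝ × ℝ)‖ ≤ 1 := by simp [Prod.norm_def]
lemma ne2 : ‖((0, 1) : ℝ × ℝ)‖ ≤ 1 := by simp [Prod.norm_def]

lemma div_form {Ω : Set (ℝ × ℝ)} (hΩ : IsOpen Ω) (hb : Bornology.IsBounded Ω)
    {ψ G1 G2 : ℝ × ℝ → ℝ} (hψ : LocallyLipschitzOn Ω ψ) (hc : HasCompactSupport ψ)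
    (ht : tsupport ψ ⊆ Ω) (h1 : LocallyLipschitzOn Ω G1) (h2 : LocallyLipschitzOn Ω G2) :
    ∫ p in Ω, ((pdv (1, 0) ψ p * G1 p + ψ p * pdv (1, 0) G1 p) +
      (pdv (0, 1) ψ p * G2 p + ψ p * pdv (0, 1) G2 p)) = 0 := by
  have a1 := int_pdv_zero hΩ (locLip_mul hψ h1) (cs_mul hc) (ts_mul ht) (1, 0)
  have a2 := int_pdv_zero hΩ (locLip_mul hψ h2) (cs_mul hc) (ts_mul ht) (0, 1)
  have i1 := integ_pdv hΩ hb (locLip_mul hψ h1) (cs_mul hc) (ts_mul ht) ne1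
  have i2 := integ_pdv hΩ hb (locLip_mul hψ h2) (cs_mul hc) (ts_mul ht) ne2
  have := integral_add i1 i2
  rw [a1, a2, add_zero] at this
  refine Eq.trans ?_ this
  apply integral_congr_ae
  filter_upwards [ae_diff hΩ hψ, ae_diff hΩ h1, ae_diff hΩ h2] with p d0 d1 d2
  rw [pdv_mul d0 d1, pdv_mul d0 d2]

/-- uniformly bounded measurable families on `Ω` -/
def BM (Ω : Set (ℝ × ℝ)) (F : ℕ → ℝ × ℝ → ℝ) : Prop :=
  (∀ n, AEStronglyMeasurable (F n) (volume.restrict Ω)) ∧ ∃ M : ℝ, 0 ≤ M ∧ ∀ n, ∀ p ∈ Ω, |F n p| ≤ M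

/-- families that are in addition pointwise null -/
def ZZ (Ω : Set (ℝ × ℝ)) (F : ℕ → ℝ × ℝ → ℝ) : Prop :=
  BM Ω F ∧ ∀ p ∈ Ω, Tendsto (fun n => F n p) atTop (𝓝 0)

lemma BM.add {Ω : Set (ℝ × ℝ)} {F G : ℕ → ℝ × ℝ → ℝ} (hF : BM Ω F) (hG : BM Ω G) :
    BM Ω (fun n p => F n p + G n p) := by
  obtain ⟨h1, M, hM0, hM⟩ := hF
  obtain ⟨h2, N, hN0, hN⟩ := hG
  exact ⟨fun n => (h1 n).add (h2 n), M + N, by positivity,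
    fun n p hp => (abs_add_le _ _).trans (add_le_add (hM n p hp) (hN n p hp))⟩

lemma BM.mul {Ω : Set (ℝ × ℝ)} {F G : ℕ → ℝ × ℝ → ℝ} (hF : BM Ω F) (hG : BM Ω G) :
    BM Ω (fun n p => F n p * G n p) := by
  obtain ⟨h1, M, hM0, hM⟩ := hF
  obtain ⟨h2, N, hN0, hN⟩ := hG
  refine ⟨fun n => (h1 n).mul (h2 n), M * N, by positivity, fun n p hp => ?_⟩
  rw [abs_mul]
  exact mul_le_mul (hM n p hp) (hN n p hp) (abs_nonneg _) hM0

lemma BM.neg {Ω : Set (ℝ × ℝ)} {F : ℕ → ℝ × ℝ → ℝ} (hF : BM Ω F) :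
    BM Ω (fun n p => - F n p) := by
  obtain ⟨h1, M, hM0, hM⟩ := hF
  exact ⟨fun n => (h1 n).neg, M, hM0, fun n p hp => by rw [abs_neg]; exact hM n p hp⟩

lemma BM.sub {Ω : Set (ℝ × ℝ)} {F G : ℕ → ℝ × ℝ → ℝ} (hF : BM Ω F) (hG : BM Ω G) :
    BM Ω (fun n p => F n p - G n p) := by
  simpa only [sub_eq_add_neg] using hF.add hG.neg

lemma BM.abs {Ω : Set (ℝ × ℝ)} {F : ℕ → ℝ × ℝ → ℝ} (hF : BM Ω F) :
    BM Ω (fun n p => |F n p|) := by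
  obtain ⟨h1, M, hM0, hM⟩ := hF
  exact ⟨fun n => (h1 n).norm, M, hM0, fun n p hp => by rw [abs_abs]; exact hM n p hp⟩

lemma BM.integ {Ω : Set (ℝ × ℝ)} (hΩ : IsOpen Ω) (hb : Bornology.IsBounded Ω)
    {F : ℕ → ℝ × ℝ → ℝ} (hF : BM Ω F) (n : ℕ) : Integrable (F n) (volume.restrict Ω) := by
  obtain ⟨h1, M, hM0, hM⟩ := hF
  exact integ_of_bdd hΩ hb (h1 n) M (hM n)

lemma BM.lip {Ω : Set (ℝ × ℝ)} (hΩ : IsOpen Ω) {F : ℕ → ℝ × ℝ → ℝ} {C : NNReal}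
    (h : ∀ n, LipschitzOnWith C (F n) Ω) (hM : ∀ n, ∀ p ∈ Ω, |F n p| ≤ C) : BM Ω F :=
  ⟨fun n => (h n).continuousOn.aestronglyMeasurable hΩ.measurableSet, C, C.2, hM⟩

lemma BM.pdv {Ω : Set (ℝ × ℝ)} (hΩ : IsOpen Ω) {F : ℕ → ℝ × ℝ → ℝ} {C : NNReal}
    (h : ∀ n, LipschitzOnWith C (F n) Ω) {e : ℝ × ℝ} (he : ‖e‖ ≤ 1) :
    BM Ω (fun n => pdv e (F n)) :=
  ⟨fun n => (pdv_meas e (F n)).aestronglyMeasurable, C, C.2,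
    fun n p hp => pdv_bound hΩ (h n) hp he⟩

lemma BM.cst {Ω : Set (ℝ × ℝ)} {c : ℕ → ℝ} (h : ∀ n, |c n| ≤ 1) : BM Ω (fun n _ => c n) :=
  ⟨fun n => aestronglyMeasurable_const, 1, zero_le_one, fun n _ _ => h n⟩

lemma ZZ.add {Ω : Set (ℝ × ℝ)} {F G : ℕ → ℝ × ℝ → ℝ} (hF : ZZ Ω F) (hG : ZZ Ω G) :
    ZZ Ω (fun n p => F n p + G n p) :=
  ⟨hF.1.add hG.1, fun p hp => by simpa using (hF.2 p hp).add (hG.2 p hp)⟩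

lemma ZZ.neg {Ω : Set (ℝ × ℝ)} {F : ℕ → ℝ × ℝ → ℝ} (hF : ZZ Ω F) :
    ZZ Ω (fun n p => - F n p) :=
  ⟨hF.1.neg, fun p hp => by simpa using (hF.2 p hp).neg⟩

lemma ZZ.mul {Ω : Set (ℝ × ℝ)} {F G : ℕ → ℝ × ℝ → ℝ} (hF : BM Ω F) (hG : ZZ Ω G) :
    ZZ Ω (fun n p => F n p * G n p) := by
  refine ⟨hF.mul hG.1, fun p hp => ?_⟩
  obtain ⟨h1, M, hM0, hM⟩ := hF
  have : Tendsto (fun n => M * |G n p|) atTop (𝓝 0) := by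
    simpa using ((hG.2 p hp).abs.const_mul M)
  refine squeeze_zero_norm (fun n => ?_) this
  rw [Real.norm_eq_abs, abs_mul]
  exact mul_le_mul_of_nonneg_right (hM n p hp) (abs_nonneg _)

lemma ZZ.of_le {Ω : Set (ℝ × ℝ)} {F G : ℕ → ℝ × ℝ → ℝ} (hF : BM Ω F) (hG : ZZ Ω G)
    (h : ∀ n, ∀ p ∈ Ω, |F n p| ≤ |G n p|) : ZZ Ω F := by
  refine ⟨hF, fun p hp => ?_⟩
  have : Tendsto (fun n => |G n p|) atTop (𝓝 0) := by
    simpa using (hG.2 p hp).abs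
  exact squeeze_zero_norm (fun n => h n p hp) this

lemma ZZ.int {Ω : Set (ℝ × ℝ)} (hΩ : IsOpen Ω) (hb : Bornology.IsBounded Ω)
    {F : ℕ → ℝ × ℝ → ℝ} (hF : ZZ Ω F) : Tendsto (fun n => ∫ p in Ω, F n p) atTop (𝓝 0) := by
  obtain ⟨⟨h1, M, hM0, hM⟩, hz⟩ := hF
  have := dct hΩ hb (f := fun _ => 0) h1 M hM hz
  simpa using this

lemma sq_to_abs {Ω : Set (ℝ × ℝ)} (hΩ : IsOpen Ω) (hb : Bornology.IsBounded Ω)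
    {D : ℕ → ℝ × ℝ → ℝ} {χ : ℝ × ℝ → ℝ} (hD : BM Ω D) (hχ : BM Ω (fun _ => χ))
    (h0 : ∀ p, 0 ≤ χ p)
    (h : Tendsto (fun n => ∫ p in Ω, χ p * (D n p * D n p)) atTop (𝓝 0)) :
    Tendsto (fun n => ∫ p in Ω, χ p * |D n p|) atTop (𝓝 0) := by
  have iχ := hχ.integ hΩ hb 0
  set I := ∫ p in Ω, χ p with hI
  have hI0 : 0 ≤ I := integral_nonneg h0
  rw [Metric.tendsto_atTop] at h ⊢
  intro ε hε
  set δ := ε / (2 * (I + 1)) with hδ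
  have hδ0 : 0 < δ := by positivity
  obtain ⟨N, hN⟩ := h (δ * ε / 2) (by positivity)
  refine ⟨N, fun n hn => ?_⟩
  have h1 := hN n hn
  rw [Real.dist_eq, sub_zero] at h1 ⊢
  have h2 := (le_abs_self _).trans_lt h1
  have hnn : 0 ≤ ∫ p in Ω, χ p * |D n p| := integral_nonneg fun p => mul_nonneg (h0 p) (abs_nonneg _)
  rw [abs_of_nonneg hnn]
  have hle : ∫ p in Ω, χ p * |D n p| ≤ ∫ p in Ω, (δ * χ p + δ⁻¹ * (χ p * (D n p * D n p))) := by
    apply integral_mono (BM.integ hΩ hb (hχ.mul hD.abs) n)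
    · exact (iχ.const_mul δ).add ((BM.integ hΩ hb (hχ.mul (hD.mul hD)) n).const_mul _)
    · intro p
      have : |D n p| ≤ δ + δ⁻¹ * (D n p * D n p) := by
        rw [← abs_mul_abs_self (D n p)]
        have h3 : δ * (δ + δ⁻¹ * (|D n p| * |D n p|)) = δ * δ + |D n p| * |D n p| := by
          field_simp
        have h4 : δ * |D n p| ≤ δ * (δ + δ⁻¹ * (|D n p| * |D n p|)) := by
          rw [h3]; nlinarith [sq_nonneg (δ - |D n p|), abs_nonneg (D n p)]
        exact le_of_mul_le_mul_left h4 hδ0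
      have := mul_le_mul_of_nonneg_left this (h0 p)
      simp only
      linarith
  rw [integral_add (iχ.const_mul δ) ((BM.integ hΩ hb (hχ.mul (hD.mul hD)) n).const_mul _),
    integral_const_mul, integral_const_mul, ← hI] at hle
  have h5 : δ * I < ε / 2 + 0 := by
    rw [hδ, add_zero, div_mul_eq_mul_div, div_lt_div_iff₀ (by positivity) (by positivity)]
    nlinarith
  have h6 : δ⁻¹ * ∫ p in Ω, χ p * (D n p * D n p) < δ⁻¹ * (δ * ε / 2) :=
    mul_lt_mul_of_pos_left h2 (by positivity)
  have h7 : δ⁻¹ * (δ * ε / 2) = ε / 2 := by field_simp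
  linarith

/-- the nonlinearity -/
def Fn (t : ℝ) : ℝ := t / Real.sqrt (1 + t ^ 2)

lemma sq1_pos (t : ℝ) : 0 < Real.sqrt (1 + t ^ 2) := Real.sqrt_pos.2 (by positivity)

lemma Fn_deriv (t : ℝ) : HasDerivAt Fn (1 / (Real.sqrt (1 + t ^ 2) * (1 + t ^ 2))) t := by
  have h1 : HasDerivAt (fun t : ℝ => 1 + t ^ 2) (2 * t) t := by
    simpa using (hasDerivAt_pow 2 t).const_add 1
  have h2 := h1.sqrt (by positivity)
  have h3 := (hasDerivAt_id t).div h2 (sq1_pos t).ne'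
  have hs := sq1_pos t
  have hq : Real.sqrt (1 + t ^ 2) ^ 2 = 1 + t ^ 2 := Real.sq_sqrt (by positivity)
  have h4 : HasDerivAt Fn
      ((1 * √(1 + t ^ 2) - id t * (2 * t / (2 * √(1 + t ^ 2)))) / √(1 + t ^ 2) ^ 2) t := h3
  refine h4.congr_deriv ?_
  rw [hq]
  simp only [id]
  set s := Real.sqrt (1 + t ^ 2)
  have : (0:ℝ) < 1 + t ^ 2 := by positivity
  field_simp
  rw [hq]; ring

lemma Fn_contDiff : ContDiff ℝ (⊤ : ℕ∞) Fn := by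
  unfold Fn
  refine contDiff_id.div (ContDiff.sqrt (by fun_prop) fun t => by positivity) fun t => (sq1_pos t).ne'

lemma Fn_cont : Continuous Fn := Fn_contDiff.continuous

lemma Fn_mono : StrictMono Fn := by
  apply strictMono_of_deriv_pos
  intro t
  rw [(Fn_deriv t).deriv]
  have := sq1_pos t
  positivity

lemma Fn_lip : LipschitzWith 1 Fn := by
  apply lipschitzWith_of_nnnorm_deriv_le (fun t => (Fn_deriv t).differentiableAt)
  intro t
  rw [(Fn_deriv t).deriv, ← NNReal.coe_le_coe, coe_nnnorm, NNReal.coe_one]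
  have := sq1_pos t
  rw [Real.norm_of_nonneg (by positivity)]
  rw [div_le_one (by positivity)]
  have h1 : 1 ≤ Real.sqrt (1 + t ^ 2) := Real.one_le_sqrt.2 (by nlinarith [sq_nonneg t])
  nlinarith [sq_nonneg t]

lemma Fn_abs (t : ℝ) : |Fn t| ≤ 1 := by
  have hs := sq1_pos t
  rw [Fn, abs_div, abs_of_pos hs, div_le_one hs]
  apply Real.abs_le_sqrt
  linarith

lemma Fn_sq_le (a b : ℝ) : (Fn a - Fn b) * (Fn a - Fn b) ≤ (Fn a - Fn b) * (a - b) := by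
  have h := Fn_lip.dist_le_mul a b
  simp only [NNReal.coe_one, one_mul, Real.dist_eq] at h
  rcases le_total a b with hab | hab
  · have := Fn_mono.monotone hab
    rw [abs_of_nonpos (by linarith), abs_of_nonpos (by linarith)] at h
    nlinarith
  · have := Fn_mono.monotone hab
    rw [abs_of_nonneg (by linarith), abs_of_nonneg (by linarith)] at h
    nlinarith

lemma Fn_near (a b : ℝ) : |Fn a - a / Real.sqrt (1 + a ^ 2 + b ^ 2)| ≤ |a * (b * b)| := by
  have hw := sq1_pos a
  have hW : 0 < Real.sqrt (1 + a ^ 2 + b ^ 2) := Real.sqrt_pos.2 (by positivity)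
  have hw1 : 1 ≤ Real.sqrt (1 + a ^ 2) := Real.one_le_sqrt.2 (by nlinarith [sq_nonneg a])
  have hW1 : Real.sqrt (1 + a ^ 2) ≤ Real.sqrt (1 + a ^ 2 + b ^ 2) :=
    Real.sqrt_le_sqrt (by nlinarith [sq_nonneg b])
  have q1 : Real.sqrt (1 + a ^ 2) ^ 2 = 1 + a ^ 2 := Real.sq_sqrt (by positivity)
  have q2 : Real.sqrt (1 + a ^ 2 + b ^ 2) ^ 2 = 1 + a ^ 2 + b ^ 2 := Real.sq_sqrt (by positivity)
  unfold Fn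
  set w := Real.sqrt (1 + a ^ 2)
  set W := Real.sqrt (1 + a ^ 2 + b ^ 2)
  have e : a / w - a / W = a * ((W - w) / (w * W)) := by field_simp
  rw [e, abs_mul, abs_mul a]
  refine mul_le_mul_of_nonneg_left ?_ (abs_nonneg _)
  rw [abs_of_nonneg (by apply div_nonneg (by linarith); positivity), abs_of_nonneg (mul_self_nonneg b),
    div_le_iff₀ (by positivity)]
  have h3 : (W - w) * (W + w) = b * b := by nlinarith
  have h4 : W - w ≤ b * b := by nlinarith
  have h5 : 1 ≤ w * W := by nlinarith
  nlinarith [mul_self_nonneg b]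


lemma integ_fsub {μ : Measure (ℝ × ℝ)} {f g : ℝ × ℝ → ℝ} (hf : Integrable f μ) (hg : Integrable g μ) :
    Integrable (fun p => f p - g p) μ := hf.sub hg

lemma weak_n {Ω : Set (ℝ × ℝ)} (hΩ : IsOpen Ω) (hb : Bornology.IsBounded Ω)
    {ε : ℝ} {b1 b2 t1 t2 h k ψ : ℝ × ℝ → ℝ}
    (hb1 : LocallyLipschitzOn Ω b1) (hb2 : LocallyLipschitzOn Ω b2)
    (ht1 : LocallyLipschitzOn Ω t1) (ht2 : LocallyLipschitzOn Ω t2)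
    (hh : LocallyLipschitzOn Ω h) (hk : LocallyLipschitzOn Ω k)
    (eq : ∀ p ∈ Ω, b1 p * pdv (1, 0) h p + b2 p * pdv (0, 1) h p +
      ε * (t1 p * pdv (1, 0) k p + t2 p * pdv (0, 1) k p) = 0)
    (hψ : LocallyLipschitzOn Ω ψ) (hc : HasCompactSupport ψ)
    (ht : tsupport ψ ⊆ Ω) :
    ∫ p in Ω, (h p * (b1 p * pdv (1, 0) ψ p + b2 p * pdv (0, 1) ψ p +
        (pdv (1, 0) b1 p + pdv (0, 1) b2 p) * ψ p) +
      ε * (k p * (t1 p * pdv (1, 0) ψ p + t2 p * pdv (0, 1) ψ p +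
        (pdv (1, 0) t1 p + pdv (0, 1) t2 p) * ψ p))) = 0 := by
  have hε : LocallyLipschitzOn Ω (fun _ : ℝ × ℝ => ε) := lipOn_locLip (LipschitzWith.const ε).lipschitzOnWith
  have l1 := locLip_mul hε (locLip_mul ht1 hk)
  have l2 := locLip_mul hε (locLip_mul ht2 hk)
  have d := div_form hΩ hb hψ hc ht (locLip_add (locLip_mul hb1 hh) l1)
    (locLip_add (locLip_mul hb2 hh) l2)
  refine Eq.trans ?_ d
  apply integral_congr_ae
  filter_upwards [ae_diff hΩ hb1, ae_diff hΩ hb2, ae_diff hΩ ht1, ae_diff hΩ ht2, ae_diff hΩ hh,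
    ae_diff hΩ hk, ae_restrict_mem hΩ.measurableSet] with p d1 d2 d3 d4 d5 d6 hp
  have e := eq p hp
  have c : ∀ e : ℝ × ℝ, pdv e (fun _ => ε) p = 0 := by intro e; simp [pdv]
  have dc : DifferentiableAt ℝ (fun _ : ℝ × ℝ => ε) p := differentiableAt_const _
  rw [pdv_add (d1.fun_mul d5) (dc.fun_mul (d3.fun_mul d6)), pdv_add (d2.fun_mul d5) (dc.fun_mul (d4.fun_mul d6)),
    pdv_mul d1 d5, pdv_mul d2 d5, pdv_mul dc (d3.fun_mul d6), pdv_mul dc (d4.fun_mul d6),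
    pdv_mul d3 d6, pdv_mul d4 d6, c, c]
  linear_combination (-ψ p) * e

set_option maxHeartbeats 1000000 in
lemma stage1_abs {Ω : Set (ℝ × ℝ)} (hΩ : IsOpen Ω) (hb : Bornology.IsBounded Ω)
    {C : NNReal} {ε : ℕ → ℝ} (hε : ∀ n, 0 < ε n ∧ ε n ≤ 1) (hε0 : Tendsto ε atTop (𝓝 0))
    {us b1 b2 t1 t2 h k v y : ℕ → ℝ × ℝ → ℝ} {u B1 B2 V : ℝ × ℝ → ℝ}
    (lus : ∀ n, LipschitzOnWith C (us n) Ω) (mus : ∀ n, ∀ p ∈ Ω, |us n p| ≤ C)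
    (lb1 : ∀ n, LipschitzOnWith C (b1 n) Ω) (mb1 : ∀ n, ∀ p ∈ Ω, |b1 n p| ≤ C)
    (lb2 : ∀ n, LipschitzOnWith C (b2 n) Ω) (mb2 : ∀ n, ∀ p ∈ Ω, |b2 n p| ≤ C)
    (lt1 : ∀ n, LipschitzOnWith C (t1 n) Ω) (mt1 : ∀ n, ∀ p ∈ Ω, |t1 n p| ≤ C)
    (lt2 : ∀ n, LipschitzOnWith C (t2 n) Ω) (mt2 : ∀ n, ∀ p ∈ Ω, |t2 n p| ≤ C)
    (lu : LipschitzOnWith C u Ω) (mu : ∀ p ∈ Ω, |u p| ≤ C)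
    (lB1 : LipschitzOnWith C B1 Ω) (mB1 : ∀ p ∈ Ω, |B1 p| ≤ C)
    (lB2 : LipschitzOnWith C B2 Ω) (mB2 : ∀ p ∈ Ω, |B2 p| ≤ C)
    (cu : ∀ p ∈ Ω, Tendsto (fun n => us n p) atTop (𝓝 (u p)))
    (cB1 : ∀ p ∈ Ω, Tendsto (fun n => b1 n p) atTop (𝓝 (B1 p)))
    (cB2 : ∀ p ∈ Ω, Tendsto (fun n => b2 n p) atTop (𝓝 (B2 p)))
    (hv : ∀ n, v n = fun p => b1 n p * pdv (1, 0) (us n) p + b2 n p * pdv (0, 1) (us n) p)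
    (hy : ∀ n, y n = fun p => t1 n p * pdv (1, 0) (us n) p + t2 n p * pdv (0, 1) (us n) p)
    (hV : V = fun p => B1 p * pdv (1, 0) u p + B2 p * pdv (0, 1) u p)
    (hh : ∀ n, h n = fun p => v n p / Real.sqrt (1 + (v n p) ^ 2 + (ε n * y n p) ^ 2))
    (hk : ∀ n, k n = fun p => ε n * y n p / Real.sqrt (1 + (v n p) ^ 2 + (ε n * y n p) ^ 2))
    (lh : ∀ n, LocallyLipschitzOn Ω (h n)) (lk : ∀ n, LocallyLipschitzOn Ω (k n))
    (eq : ∀ n, ∀ p ∈ Ω, b1 n p * pdv (1, 0) (h n) p + b2 n p * pdv (0, 1) (h n) p +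
      ε n * (t1 n p * pdv (1, 0) (k n) p + t2 n p * pdv (0, 1) (k n) p) = 0)
    {χ φ : ℝ × ℝ → ℝ} (hχ : IsTest Ω χ) (χ0 : ∀ p, 0 ≤ χ p) (hφ : IsTest Ω φ)
    (hχ1 : ∀ p ∈ tsupport φ, χ p = 1) :
    ∫ p in Ω, Fn (V p) * (B1 p * pdv (1, 0) φ p + B2 p * pdv (0, 1) φ p +
        (pdv (1, 0) B1 p + pdv (0, 1) B2 p) * φ p) = 0 := by
  have rm := hΩ.measurableSet
  -- basic families
  have Bus1 := BM.pdv hΩ lus ne1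
  have Bus2 := BM.pdv hΩ lus ne2
  have Bu1 := BM.pdv hΩ (F := fun _ => u) (fun _ => lu) ne1
  have Bu2 := BM.pdv hΩ (F := fun _ => u) (fun _ => lu) ne2
  have Bb1 := BM.lip hΩ lb1 mb1
  have Bb2 := BM.lip hΩ lb2 mb2
  have Bt1 := BM.lip hΩ lt1 mt1
  have Bt2 := BM.lip hΩ lt2 mt2
  have BB1 := BM.lip hΩ (F := fun _ => B1) (fun _ => lB1) (fun _ => mB1)
  have BB2 := BM.lip hΩ (F := fun _ => B2) (fun _ => lB2) (fun _ => mB2)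
  have Bdb1 := BM.pdv hΩ lb1 ne1
  have Bdb2 := BM.pdv hΩ lb2 ne2
  have Bdt1 := BM.pdv hΩ lt1 ne1
  have Bdt2 := BM.pdv hΩ lt2 ne2
  have BdB1 := BM.pdv hΩ (F := fun _ => B1) (fun _ => lB1) ne1
  have BdB2 := BM.pdv hΩ (F := fun _ => B2) (fun _ => lB2) ne2
  have Bv : BM Ω v := by
    have := (Bb1.mul Bus1).add (Bb2.mul Bus2)
    rwa [show v = _ from funext hv]
  have By : BM Ω y := by
    have := (Bt1.mul Bus1).add (Bt2.mul Bus2)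
    rwa [show y = _ from funext hy]
  have BV : BM Ω (fun _ => V) := by
    have := (BB1.mul Bu1).add (BB2.mul Bu2)
    rwa [hV]
  have Bε : BM Ω (fun n _ => ε n) := BM.cst fun n => by
    rw [abs_of_pos (hε n).1]; exact (hε n).2
  have Zε : ZZ Ω (fun n _ => ε n) := ⟨Bε, fun p _ => hε0⟩
  have sqp : ∀ a b : ℝ, 0 < Real.sqrt (1 + a ^ 2 + b ^ 2) := fun a b => Real.sqrt_pos.2 (by positivity)
  have Bh : BM Ω h := by
    refine ⟨fun n => (lh n).continuousOn.aestronglyMeasurable rm, 1, zero_le_one, fun n p hp => ?_⟩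
    rw [hh n]
    simp only
    rw [abs_div, abs_of_pos (sqp _ _), div_le_one (sqp _ _)]
    apply Real.abs_le_sqrt
    nlinarith [sq_nonneg (ε n * y n p)]
  have Bk : BM Ω k := by
    refine ⟨fun n => (lk n).continuousOn.aestronglyMeasurable rm, 1, zero_le_one, fun n p hp => ?_⟩
    rw [hk n]
    simp only
    rw [abs_div, abs_of_pos (sqp _ _), div_le_one (sqp _ _)]
    apply Real.abs_le_sqrt
    nlinarith [sq_nonneg (v n p)]
  have BFn : ∀ {w : ℕ → ℝ × ℝ → ℝ}, BM Ω w → BM Ω (fun n p => Fn (w n p)) := by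
    intro w hw
    exact ⟨fun n => Fn_cont.comp_aestronglyMeasurable (hw.1 n), 1, zero_le_one, fun n p _ => Fn_abs _⟩
  have BFv := BFn Bv
  have BFV := BFn BV
  have ZFh : ZZ Ω (fun n p => Fn (v n p) - h n p) := by
    refine ZZ.of_le (G := fun n p => v n p * ((ε n * y n p) * (ε n * y n p))) (BFv.sub Bh) ?_ ?_
    · have z1 : ZZ Ω (fun n p => y n p * ε n) := ZZ.mul By Zε
      have z2 := ZZ.mul Bv (ZZ.mul z1.1 z1)
      refine ⟨?_, fun p hp => ?_⟩
      · convert z2.1 using 3; ring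
      · convert z2.2 p hp using 2; ring
    · intro n p _
      rw [hh n]
      exact Fn_near _ _
  have Zb1 : ZZ Ω (fun n p => b1 n p - B1 p) :=
    ⟨Bb1.sub BB1, fun p hp => by simpa using (cB1 p hp).sub_const (B1 p)⟩
  have Zb2 : ZZ Ω (fun n p => b2 n p - B2 p) :=
    ⟨Bb2.sub BB2, fun p hp => by simpa using (cB2 p hp).sub_const (B2 p)⟩
  have Zu : ZZ Ω (fun n p => us n p - u p) :=
    ⟨(BM.lip hΩ lus mus).sub (BM.lip hΩ (F := fun _ => u) (fun _ => lu) (fun _ => mu)),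
      fun p hp => by simpa using (cu p hp).sub_const (u p)⟩
  have Btest : ∀ {θ : ℝ × ℝ → ℝ}, IsTest Ω θ → BM Ω (fun _ => θ) ∧
      ∀ e : ℝ × ℝ, BM Ω (fun _ => pdv e θ) := by
    intro θ hθ
    obtain ⟨A, hA0, hA⟩ := test_bdd hθ.1.continuous hθ.2.1
    refine ⟨⟨fun _ => hθ.1.continuous.aestronglyMeasurable, A, hA0, fun _ p _ => hA p⟩, fun e => ?_⟩
    obtain ⟨hc, A', hA'0, hA'⟩ := test_pdv hθ.1 hθ.2.1 e
    exact ⟨fun _ => hc.aestronglyMeasurable, A', hA'0, fun _ p _ => hA' p⟩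
  obtain ⟨Bχ, Bdχ⟩ := Btest hχ
  obtain ⟨Bφ, Bdφ⟩ := Btest hφ
  have BvV : BM Ω (fun n p => v n p - V p) := Bv.sub BV
  -- (B)
  have HB : Tendsto (fun n => ∫ p in Ω, χ p * (h n p * (v n p - V p))) atTop (𝓝 0) := by
    let R : ℕ → ℝ × ℝ → ℝ := fun n p =>
      h n p * (b1 n p * pdv (1, 0) χ p + b2 n p * pdv (0, 1) χ p +
        (pdv (1, 0) (b1 n) p + pdv (0, 1) (b2 n) p) * χ p) * (us n p - u p) +
      (-((h n p * χ p * pdv (1, 0) u p) * (b1 n p - B1 p)) +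
        -((h n p * χ p * pdv (0, 1) u p) * (b2 n p - B2 p))) +
      (k n p * (t1 n p * (pdv (1, 0) χ p * (us n p - u p) +
            χ p * (pdv (1, 0) (us n) p - pdv (1, 0) u p)) +
          t2 n p * (pdv (0, 1) χ p * (us n p - u p) +
            χ p * (pdv (0, 1) (us n) p - pdv (0, 1) u p)) +
        (pdv (1, 0) (t1 n) p + pdv (0, 1) (t2 n) p) * (χ p * (us n p - u p)))) * ε n
    have ZR : ZZ Ω R := by
      refine ((ZZ.mul ?_ Zu).add (((ZZ.mul ?_ Zb1).neg).add ((ZZ.mul ?_ Zb2).neg))).add (ZZ.mul ?_ Zε)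
      · exact Bh.mul (((Bb1.mul (Bdχ _)).add (Bb2.mul (Bdχ _))).add ((Bdb1.add Bdb2).mul Bχ))
      · exact (Bh.mul Bχ).mul Bu1
      · exact (Bh.mul Bχ).mul Bu2
      · exact Bk.mul (((Bt1.mul (((Bdχ _).mul Zu.1).add (Bχ.mul (Bus1.sub Bu1)))).add
          (Bt2.mul (((Bdχ _).mul Zu.1).add (Bχ.mul (Bus2.sub Bu2))))).add
          ((Bdt1.add Bdt2).mul (Bχ.mul Zu.1)))
    have hR := (ZR.int hΩ hb).neg
    rw [neg_zero] at hR
    refine hR.congr fun n => ?_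
    have lχ : LocallyLipschitzOn Ω χ := smooth_locLip hχ.1
    have ld := locLip_sub (lipOn_locLip (lus n)) (lipOn_locLip lu)
    have w := weak_n hΩ hb (lipOn_locLip (lb1 n)) (lipOn_locLip (lb2 n)) (lipOn_locLip (lt1 n))
      (lipOn_locLip (lt2 n)) (lh n) (lk n) (eq n)
      (locLip_mul lχ ld) (cs_mul hχ.2.1) (ts_mul hχ.2.2)
    have e : ∫ p in Ω, (χ p * (h n p * (v n p - V p)) + R n p) = 0 := by
      refine Eq.trans ?_ w
      apply integral_congr_ae
      filter_upwards [ae_diff hΩ lχ, ae_diff hΩ (lipOn_locLip (lus n)),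
        ae_diff hΩ (lipOn_locLip lu)] with p d1 d2 d3
      rw [pdv_mul d1 (d2.fun_sub d3), pdv_mul d1 (d2.fun_sub d3), pdv_sub d2 d3, pdv_sub d2 d3]
      simp only [R]
      rw [hv n, hV]
      ring
    rw [integral_add (BM.integ hΩ hb (Bχ.mul (Bh.mul BvV)) n) (BM.integ hΩ hb ZR.1 n)] at e
    linarith
  -- (C)
  have HC : Tendsto (fun n => ∫ p in Ω, χ p * (Fn (V p) * (v n p - V p))) atTop (𝓝 0) := by
    have w1 := weakconv hΩ hb hχ lu mu lus mus cu
      (ρ := fun p => Fn (V p) * B1 p) (BM.integ hΩ hb (BFV.mul BB1) 0) ne1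
    have w2 := weakconv hΩ hb hχ lu mu lus mus cu
      (ρ := fun p => Fn (V p) * B2 p) (BM.integ hΩ hb (BFV.mul BB2) 0) ne2
    have ZR : ZZ Ω (fun n p => (χ p * (Fn (V p) * pdv (1, 0) (us n) p)) * (b1 n p - B1 p) +
      (χ p * (Fn (V p) * pdv (0, 1) (us n) p)) * (b2 n p - B2 p)) :=
      (ZZ.mul (Bχ.mul (BFV.mul Bus1)) Zb1).add (ZZ.mul (Bχ.mul (BFV.mul Bus2)) Zb2)
    have w3 := ZR.int hΩ hb
    have w := ((w1.add w2).add w3).sub_const (∫ p in Ω, χ p * (Fn (V p) * V p))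
    have iV := BM.integ hΩ hb (Bχ.mul (BFV.mul BV)) 0
    have lim0 : (∫ p in Ω, χ p * (Fn (V p) * B1 p * pdv (1, 0) u p)) +
        (∫ p in Ω, χ p * (Fn (V p) * B2 p * pdv (0, 1) u p)) + 0 -
        (∫ p in Ω, χ p * (Fn (V p) * V p)) = 0 := by
      rw [← integral_add (BM.integ hΩ hb (Bχ.mul ((BFV.mul BB1).mul Bu1)) 0)
        (BM.integ hΩ hb (Bχ.mul ((BFV.mul BB2).mul Bu2)) 0), add_zero, sub_eq_zero]
      congr 1; ext p
      rw [hV]; ring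
    rw [lim0] at w
    refine w.congr fun n => ?_
    have j1 := BM.integ hΩ hb (Bχ.mul ((BFV.mul BB1).mul Bus1)) n
    have j2 := BM.integ hΩ hb (Bχ.mul ((BFV.mul BB2).mul Bus2)) n
    have j3 := BM.integ hΩ hb ZR.1 n
    rw [← integral_add j1 j2, ← integral_add (j1.fun_add j2) j3, ← integral_sub ((j1.fun_add j2).fun_add j3) iV]
    congr 1; ext p
    rw [hv n]; ring
  -- monotonicity
  have HD : Tendsto (fun n => ∫ p in Ω, χ p * ((Fn (v n p) - Fn (V p)) * (v n p - V p)))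
      atTop (𝓝 0) := by
    have ZR := ZZ.mul (Bχ.mul BvV) ZFh
    have w := (HB.sub HC).add (ZR.int hΩ hb)
    simp only [sub_zero, add_zero] at w
    refine w.congr fun n => ?_
    have j1 := BM.integ hΩ hb (Bχ.mul (Bh.mul BvV)) n
    have j2 := BM.integ hΩ hb (Bχ.mul (BFV.mul BvV)) n
    have j3 := BM.integ hΩ hb ZR.1 n
    rw [← integral_sub j1 j2, ← integral_add (integ_fsub j1 j2) j3]
    congr 1; ext p; ring
  have BD : BM Ω (fun n p => Fn (v n p) - Fn (V p)) := BFv.sub BFV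
  have HS : Tendsto (fun n => ∫ p in Ω, χ p * ((Fn (v n p) - Fn (V p)) * (Fn (v n p) - Fn (V p))))
      atTop (𝓝 0) := by
    refine squeeze_zero (fun n => integral_nonneg fun p => mul_nonneg (χ0 p) (mul_self_nonneg _))
      (fun n => ?_) HD
    refine integral_mono (BM.integ hΩ hb (Bχ.mul (BD.mul BD)) n)
      (BM.integ hΩ hb (Bχ.mul (BD.mul BvV)) n) fun p => ?_
    exact mul_le_mul_of_nonneg_left (Fn_sq_le _ _) (χ0 p)
  have HA := sq_to_abs hΩ hb BD Bχ χ0 HS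
  -- (A)
  have BQ : BM Ω (fun n p => b1 n p * pdv (1, 0) φ p + b2 n p * pdv (0, 1) φ p +
        (pdv (1, 0) (b1 n) p + pdv (0, 1) (b2 n) p) * φ p) :=
    ((Bb1.mul (Bdφ _)).add (Bb2.mul (Bdφ _))).add ((Bdb1.add Bdb2).mul Bφ)
  set Q : ℕ → ℝ × ℝ → ℝ := fun n p => b1 n p * pdv (1, 0) φ p + b2 n p * pdv (0, 1) φ p +
        (pdv (1, 0) (b1 n) p + pdv (0, 1) (b2 n) p) * φ p with hQ
  have Qχ : ∀ n p, Q n p = χ p * Q n p := by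
    intro n p
    by_cases hp : p ∈ tsupport φ
    · rw [hχ1 p hp, one_mul]
    · have : Q n p = 0 := by
        simp only [hQ]
        rw [pdv_zero_of_notMem hp, pdv_zero_of_notMem hp, image_eq_zero_of_notMem_tsupport hp]
        ring
      rw [this, mul_zero]
  have A1 : Tendsto (fun n => ∫ p in Ω, h n p * Q n p) atTop (𝓝 0) := by
    have ZR := ZZ.mul (Bk.mul (((Bt1.mul (Bdφ (1, 0))).add (Bt2.mul (Bdφ (0, 1)))).add ((Bdt1.add Bdt2).mul Bφ))) Zε
    have hR := (ZR.int hΩ hb).neg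
    rw [neg_zero] at hR
    refine hR.congr fun n => ?_
    have w := weak_n hΩ hb (lipOn_locLip (lb1 n)) (lipOn_locLip (lb2 n)) (lipOn_locLip (lt1 n))
      (lipOn_locLip (lt2 n)) (lh n) (lk n) (eq n)
      (smooth_locLip hφ.1) hφ.2.1 hφ.2.2
    have e := integral_add (BM.integ hΩ hb (Bh.mul BQ) n) (BM.integ hΩ hb ZR.1 n)
    have e2 : ∫ p in Ω, (h n p * Q n p + k n p * (t1 n p * pdv (1, 0) φ p + t2 n p * pdv (0, 1) φ p +
        (pdv (1, 0) (t1 n) p + pdv (0, 1) (t2 n) p) * φ p) * ε n) = 0 := by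
      refine Eq.trans ?_ w
      congr 1; ext p
      simp only [hQ]; ring
    linarith
  have A2 : Tendsto (fun n => ∫ p in Ω, (Fn (v n p) - Fn (V p)) * Q n p) atTop (𝓝 0) := by
    obtain ⟨-, M, hM0, hM⟩ := id BQ
    have := HA.const_mul M
    rw [mul_zero] at this
    refine squeeze_zero_norm (fun n => ?_) this
    rw [← integral_const_mul]
    refine (norm_integral_le_integral_norm _).trans ?_
    refine integral_mono_ae (BM.integ hΩ hb (BD.mul BQ) n).norm
      ((BM.integ hΩ hb (Bχ.mul BD.abs) n).const_mul M) ?_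
    filter_upwards [ae_restrict_mem rm] with p hp
    rw [Qχ n p, norm_mul, norm_mul, Real.norm_eq_abs, Real.norm_eq_abs, Real.norm_eq_abs,
      abs_of_nonneg (χ0 p)]
    have := mul_le_mul_of_nonneg_left (hM n p hp)
      (mul_nonneg (abs_nonneg (Fn (v n p) - Fn (V p))) (χ0 p))
    linarith
  have A3 : Tendsto (fun n => ∫ p in Ω, Fn (V p) * Q n p) atTop (𝓝 0) := by
    have w := (A1.add ((ZZ.mul BQ ZFh).int hΩ hb)).sub A2
    simp only [sub_zero, add_zero] at w
    refine w.congr fun n => ?_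
    have j1 := BM.integ hΩ hb (Bh.mul BQ) n
    have j2 := BM.integ hΩ hb (ZZ.mul BQ ZFh).1 n
    have j3 := BM.integ hΩ hb (BD.mul BQ) n
    rw [← integral_add j1 j2, ← integral_sub (j1.fun_add j2) j3]
    congr 1; ext p; ring
  refine tendsto_nhds_unique ?_ A3
  have w1 := weakconv hΩ hb hφ lB1 mB1 lb1 mb1 cB1
      (ρ := fun p => Fn (V p)) (BM.integ hΩ hb BFV 0) ne1
  have w2 := weakconv hΩ hb hφ lB2 mB2 lb2 mb2 cB2
      (ρ := fun p => Fn (V p)) (BM.integ hΩ hb BFV 0) ne2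
  have ZR : ZZ Ω (fun n p => (pdv (1, 0) φ p * Fn (V p)) * (b1 n p - B1 p) +
      (pdv (0, 1) φ p * Fn (V p)) * (b2 n p - B2 p)) :=
      (ZZ.mul ((Bdφ _).mul BFV) Zb1).add (ZZ.mul ((Bdφ _).mul BFV) Zb2)
  have w3 := ZR.int hΩ hb
  have BL : BM Ω (fun _ p => Fn (V p) * (B1 p * pdv (1, 0) φ p + B2 p * pdv (0, 1) φ p)) :=
    BFV.mul ((BB1.mul (Bdφ _)).add (BB2.mul (Bdφ _)))
  have w := ((w1.add w2).add w3).add_const (∫ p in Ω, Fn (V p) * (B1 p * pdv (1, 0) φ p + B2 p * pdv (0, 1) φ p))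
  rw [add_zero] at w
  have iL := BM.integ hΩ hb BL 0
  have i1 := BM.integ hΩ hb (Bφ.mul (BFV.mul BdB1)) 0
  have i2 := BM.integ hΩ hb (Bφ.mul (BFV.mul BdB2)) 0
  rw [← integral_add i1 i2, ← integral_add (i1.fun_add i2) iL] at w
  convert w using 1
  · ext n
    have j1 := BM.integ hΩ hb (Bφ.mul (BFV.mul Bdb1)) n
    have j2 := BM.integ hΩ hb (Bφ.mul (BFV.mul Bdb2)) n
    have j3 := BM.integ hΩ hb ZR.1 n
    rw [← integral_add j1 j2, ← integral_add (j1.fun_add j2) j3, ← integral_add ((j1.fun_add j2).fun_add j3) iL]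
    congr 1; ext p; simp only [hQ]; ring
  · congr 2; ext p; ring

lemma comp_lip {Ω : Set (ℝ × ℝ)} (hb : Bornology.IsBounded Ω) {s : ℝ × ℝ × ℝ → ℝ}
    (hs : ContDiff ℝ (⊤ : ℕ∞) s) (l : NNReal) :
    ∃ C : NNReal, ∀ w : ℝ × ℝ → ℝ, LipschitzOnWith l w Ω → (∀ p ∈ Ω, |w p| ≤ l) →
      LipschitzOnWith C (fun q => s (q.1, q.2, w q)) Ω ∧ ∀ p ∈ Ω, |s (p.1, p.2, w p)| ≤ C := by
  obtain ⟨R, hR⟩ := hb.exists_norm_le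
  set K := Metric.closedBall (0 : ℝ × ℝ × ℝ) (max R l) with hK
  have hKc : IsCompact K := isCompact_closedBall _ _
  have hl : LocallyLipschitz s :=
    ContDiff.locallyLipschitz (𝕂 := ℝ) (hs.of_le (by exact_mod_cast le_top))
  obtain ⟨C1, hC1⟩ := (hl.locallyLipschitzOn (s := K)).exists_lipschitzOnWith_of_compact hKc
  obtain ⟨C2, hC2⟩ := hKc.exists_bound_of_continuousOn hs.continuous.continuousOn
  have hmem : ∀ w : ℝ × ℝ → ℝ, (∀ p ∈ Ω, |w p| ≤ l) → ∀ p ∈ Ω, (p.1, p.2, w p) ∈ K := by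
    intro w hw p hp
    have h1 := hR p hp
    rw [hK, mem_closedBall_zero_iff]
    simp only [Prod.norm_def] at h1 ⊢
    exact max_le (((le_max_left _ _).trans h1).trans (le_max_left _ _))
      (max_le (((le_max_right _ _).trans h1).trans (le_max_left _ _))
        ((hw p hp).trans (le_max_right _ _)))
  refine ⟨max (C1 * max 1 (max 1 l)) (Real.toNNReal C2), fun w hw hwb => ⟨?_, fun p hp => ?_⟩⟩
  · have h1 : LipschitzOnWith (max 1 (max 1 l)) (fun q : ℝ × ℝ => (q.1, q.2, w q)) Ω :=
      (LipschitzWith.prod_fst.lipschitzOnWith).prodMk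
        ((LipschitzWith.prod_snd.lipschitzOnWith).prodMk hw)
    have h2 := hC1.comp h1 (fun p hp => hmem w hwb p hp)
    exact h2.weaken (le_max_left _ _)
  · have := hC2 _ (hmem w hwb p hp)
    rw [Real.norm_eq_abs] at this
    refine this.trans ((Real.le_coe_toNNReal C2).trans ?_)
    exact_mod_cast le_max_right _ _

lemma pd3_smooth {s : ℝ × ℝ × ℝ → ℝ} (hs : ContDiff ℝ (⊤ : ℕ∞) s) :
    ContDiff ℝ (⊤ : ℕ∞) (pd3 s) :=
  (hs.fderiv_right (m := (⊤ : ℕ∞)) (by simp)).clm_apply contDiff_const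

lemma pdv_smooth {f : ℝ × ℝ → ℝ} (hs : ContDiff ℝ (⊤ : ℕ∞) f) (e : ℝ × ℝ) :
    ContDiff ℝ (⊤ : ℕ∞) (pdv e f) :=
  (hs.fderiv_right (m := (⊤ : ℕ∞)) (by simp)).clm_apply contDiff_const

lemma VF_smooth {a b : ℝ × ℝ × ℝ → ℝ} {u f : ℝ × ℝ → ℝ} (ha : ContDiff ℝ (⊤ : ℕ∞) a)
    (hb : ContDiff ℝ (⊤ : ℕ∞) b) (hu : ContDiff ℝ (⊤ : ℕ∞) u) (hf : ContDiff ℝ (⊤ : ℕ∞) f) :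
    ContDiff ℝ (⊤ : ℕ∞) (VF a b u f) := by
  have h1 := pdv_smooth hf (1, 0)
  have h2 := pdv_smooth hf (0, 1)
  have hg : ContDiff ℝ (⊤ : ℕ∞) (fun p : ℝ × ℝ => (p.1, p.2, u p)) :=
    contDiff_fst.prodMk (contDiff_snd.prodMk hu)
  exact ((ha.comp hg).mul h1).add ((hb.comp hg).mul h2)

lemma exists_cut {Ω : Set (ℝ × ℝ)} (hΩ : IsOpen Ω) {K : Set (ℝ × ℝ)} (hK : IsCompact K)
    (h : K ⊆ Ω) : ∃ χ, IsTest Ω χ ∧ (∀ p, 0 ≤ χ p) ∧ ∀ p ∈ K, χ p = 1 := by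
  obtain ⟨L, hL, hKL, hLΩ⟩ := exists_compact_between hK hΩ h
  obtain ⟨f, hf, hr, hs, h1⟩ := exists_contMDiff_support_eq_eq_one_iff
    (n := (⊤ : ℕ∞)) (modelWithCornersSelf ℝ (ℝ × ℝ)) (isOpen_interior (s := L)) hK.isClosed hKL
  have hts : tsupport f ⊆ L := by
    rw [tsupport, hs]; exact closure_minimal interior_subset hL.isClosed
  refine ⟨f, ⟨hf.contDiff, hL.of_isClosed_subset (isClosed_tsupport f) hts, hts.trans hLΩ⟩,
    fun p => (hr ⟨p, rfl⟩).1, fun p hp => (h1 p).1 hp⟩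

lemma stage1 {s11 s12 : ℝ × ℝ × ℝ → ℝ} {Ω : Set (ℝ × ℝ)} {u : ℝ × ℝ → ℝ} (hΩ : IsOpen Ω)
    (hb : Bornology.IsBounded Ω) (hs1 : ContDiff ℝ (⊤ : ℕ∞) s11) (hs2 : ContDiff ℝ (⊤ : ℕ∞) s12)
    (hu : IsVVSol s11 s12 Ω u) :
    ∃ C : NNReal, (LipschitzOnWith C u Ω ∧ ∀ p ∈ Ω, |u p| ≤ C) ∧
      (LipschitzOnWith C (fun q => s11 (q.1, q.2, u q)) Ω ∧ ∀ p ∈ Ω, |s11 (p.1, p.2, u p)| ≤ C) ∧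
      (LipschitzOnWith C (fun q => s12 (q.1, q.2, u q)) Ω ∧ ∀ p ∈ Ω, |s12 (p.1, p.2, u p)| ≤ C) ∧
      ∀ φ, IsTest Ω φ → ∫ p in Ω, Fn (X1 s11 s12 u u p) *
        (X1 s11 s12 u φ p + m1 s11 s12 u p * φ p) = 0 := by
  obtain ⟨ε, us, l, hε, hε0, sm, hL, lus, mus, conv⟩ := hu
  have cu : ∀ p ∈ Ω, Tendsto (fun n => us n p) atTop (𝓝 (u p)) := fun p hp =>
    (conv {p} (by simpa using hp) isCompact_singleton).tendsto_at rfl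
  have lu : LipschitzOnWith l u Ω := by
    rw [lipschitzOnWith_iff_dist_le_mul]
    intro x hx y hy
    refine le_of_tendsto ((cu x hx).dist (cu y hy)) (Eventually.of_forall fun n => ?_)
    exact (lus n).dist_le_mul x hx y hy
  have mu : ∀ p ∈ Ω, |u p| ≤ l := fun p hp =>
    le_of_tendsto (cu p hp).abs (Eventually.of_forall fun n => mus n p hp)
  obtain ⟨C1, h1⟩ := comp_lip hb hs1 l
  obtain ⟨C2, h2⟩ := comp_lip hb hs2 l
  obtain ⟨C3, h3⟩ := comp_lip hb (pd3_smooth hs1) l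
  obtain ⟨C4, h4⟩ := comp_lip hb (pd3_smooth hs2) l
  set C := l + C1 + C2 + C3 + C4 with hC
  have e0 : l ≤ C := by rw [hC]; simp only [add_assoc]; exact le_self_add
  have e1 : C1 ≤ C := by
    rw [hC]; calc C1 ≤ C1 + (l + C2 + C3 + C4) := le_self_add
      _ = _ := by ring
  have e2 : C2 ≤ C := by
    rw [hC]; calc C2 ≤ C2 + (l + C1 + C3 + C4) := le_self_add
      _ = _ := by ring
  have e3 : C3 ≤ C := by
    rw [hC]; calc C3 ≤ C3 + (l + C1 + C2 + C4) := le_self_add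
      _ = _ := by ring
  have e4 : C4 ≤ C := by
    rw [hC]; calc C4 ≤ C4 + (l + C1 + C2 + C3) := le_self_add
      _ = _ := by ring
  have up : ∀ {D : NNReal} {f : ℝ × ℝ → ℝ}, D ≤ C →
      (LipschitzOnWith D f Ω ∧ ∀ p ∈ Ω, |f p| ≤ D) → (LipschitzOnWith C f Ω ∧ ∀ p ∈ Ω, |f p| ≤ C) :=
    fun hD h => ⟨h.1.weaken hD, fun p hp => (h.2 p hp).trans (by exact_mod_cast hD)⟩
  refine ⟨C, up e0 ⟨lu, mu⟩, up e1 (h1 u lu mu), up e2 (h2 u lu mu), fun φ hφ => ?_⟩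
  obtain ⟨χ, hχ, χ0, hχ1⟩ := exists_cut hΩ hφ.2.1.isCompact hφ.2.2
  have hv : ∀ n, ContDiff ℝ (⊤ : ℕ∞) (X1 s11 s12 (us n) (us n)) := fun n =>
    VF_smooth hs1 hs2 (sm n) (sm n)
  have hy : ∀ n, ContDiff ℝ (⊤ : ℕ∞) (Yf s11 s12 (us n) (us n)) := fun n =>
    VF_smooth (pd3_smooth hs1) (pd3_smooth hs2) (sm n) (sm n)
  have hW : ∀ n, Wt s11 s12 (ε n) (us n) = fun p =>
      Real.sqrt (1 + (X1 s11 s12 (us n) (us n) p) ^ 2 + (ε n * Yf s11 s12 (us n) (us n) p) ^ 2) := by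
    intro n; ext p
    rw [Wt, gradN, Real.sq_sqrt (by positivity), X2, add_assoc]
  have hWs : ∀ n, ContDiff ℝ (⊤ : ℕ∞) (fun p =>
      Real.sqrt (1 + (X1 s11 s12 (us n) (us n) p) ^ 2 + (ε n * Yf s11 s12 (us n) (us n) p) ^ 2)) :=
    fun n => ContDiff.sqrt ((contDiff_const.add ((hv n).pow 2)).add ((contDiff_const.mul (hy n)).pow 2))
      fun p => by positivity
  have hWp : ∀ n p, Real.sqrt (1 + (X1 s11 s12 (us n) (us n) p) ^ 2 +
      (ε n * Yf s11 s12 (us n) (us n) p) ^ 2) ≠ 0 := fun n p =>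
    (Real.sqrt_pos.2 (by positivity)).ne'
  have key := stage1_abs hΩ hb hε hε0 (us := us) (u := u)
    (fun n => (up e0 ⟨lus n, mus n⟩).1) (fun n => (up e0 ⟨lus n, mus n⟩).2)
    (fun n => (up e1 (h1 (us n) (lus n) (mus n))).1) (fun n => (up e1 (h1 (us n) (lus n) (mus n))).2)
    (fun n => (up e2 (h2 (us n) (lus n) (mus n))).1) (fun n => (up e2 (h2 (us n) (lus n) (mus n))).2)
    (fun n => (up e3 (h3 (us n) (lus n) (mus n))).1) (fun n => (up e3 (h3 (us n) (lus n) (mus n))).2)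
    (fun n => (up e4 (h4 (us n) (lus n) (mus n))).1) (fun n => (up e4 (h4 (us n) (lus n) (mus n))).2)
    (up e0 ⟨lu, mu⟩).1 (up e0 ⟨lu, mu⟩).2 (up e1 (h1 u lu mu)).1 (up e1 (h1 u lu mu)).2
    (up e2 (h2 u lu mu)).1 (up e2 (h2 u lu mu)).2 cu
    (fun p hp => (hs1.continuous.tendsto _).comp
      (tendsto_const_nhds.prodMk_nhds (tendsto_const_nhds.prodMk_nhds (cu p hp))))
    (fun p hp => (hs2.continuous.tendsto _).comp
      (tendsto_const_nhds.prodMk_nhds (tendsto_const_nhds.prodMk_nhds (cu p hp))))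
    (v := fun n => X1 s11 s12 (us n) (us n)) (y := fun n => Yf s11 s12 (us n) (us n))
    (V := X1 s11 s12 u u) (fun n => rfl) (fun n => rfl) rfl (fun n => rfl) (fun n => rfl)
    (fun n => smooth_locLip ((hv n).div (hWs n) (hWp n)))
    (fun n => smooth_locLip ((contDiff_const.mul (hy n)).div (hWs n) (hWp n)))
    (fun n p hp => by
      have := hL n p hp
      rw [Lop, hW] at this
      exact this)
    hχ χ0 hφ hχ1
  exact key

lemma flow {b : ℝ × ℝ → ℝ × ℝ} {C : NNReal} (hl : LipschitzWith C b) (hbd : ∀ x, ‖b x‖ ≤ C)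
    (p0 : ℝ × ℝ) {r : ℝ} (hr : 0 < r) :
    ∃ T > 0, ∃ Φ : ℝ × ℝ → ℝ → ℝ × ℝ, ∃ L : NNReal,
      (∀ x ∈ Metric.closedBall p0 r, Φ x 0 = x ∧ ∀ t ∈ Set.Icc 0 T,
        HasDerivWithinAt (Φ x) (b (Φ x t)) (Set.Icc 0 T) t) ∧
      (∀ t ∈ Set.Icc 0 T, LipschitzOnWith L (fun x => Φ x t) (Metric.closedBall p0 r)) ∧
      (∀ t ∈ Set.Icc 0 T, ∀ x ∈ Metric.closedBall p0 r, ∀ y ∈ Metric.closedBall p0 r,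
        dist x y ≤ 2 * dist (Φ x t) (Φ y t)) ∧
      (∀ t ∈ Set.Icc 0 T, ∀ x ∈ Metric.closedBall p0 r, dist (Φ x t) x ≤ r) ∧
      ContinuousOn (fun z : (ℝ × ℝ) × ℝ => Φ z.1 z.2) (Metric.closedBall p0 r ×ˢ Set.Icc 0 T) := by
  set T0 : ℝ := r / (C + 1) with hT0
  have hT0p : 0 < T0 := by positivity
  have hCT0 : C * T0 ≤ r := by
    rw [hT0, mul_div_assoc', div_le_iff₀ (by positivity)]
    nlinarith [C.2]
  have PL : IsPicardLindelof (fun _ : ℝ => b) (tmin := 0) (tmax := T0) ⟨0, le_rfl, hT0p.le⟩ p0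
      (⟨2 * r, by positivity⟩ : NNReal) ⟨r, hr.le⟩ C C := by
    refine IsPicardLindelof.of_time_independent (fun x _ => hbd x) hl.lipschitzOnWith ?_
    simp only [sub_zero, sub_self]
    rw [max_eq_left hT0p.le]
    show (C : ℝ) * T0 ≤ 2 * r - r
    linarith
  obtain ⟨Φ, h1, L, h2⟩ := PL.exists_forall_mem_closedBall_eq_hasDerivWithinAt_lipschitzOnWith
  simp only [NNReal.coe_mk] at h1 h2
  set T := min T0 (1 / (2 * (C * L + 1))) with hT
  have hTp : 0 < T := lt_min hT0p (by positivity)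
  have hTT : T ≤ T0 := min_le_left _ _
  have hT2 : (C * L) * T ≤ 1 / 2 := by
    have : T ≤ 1 / (2 * (C * L + 1)) := min_le_right _ _
    rw [le_div_iff₀ (by positivity)] at this
    nlinarith [C.2, L.2, mul_nonneg C.2 L.2]
  have hsub : Set.Icc 0 T ⊆ Set.Icc 0 T0 := Set.Icc_subset_Icc_right hTT
  have hder : ∀ x ∈ Metric.closedBall p0 r, ∀ t ∈ Set.Icc 0 T,
        HasDerivWithinAt (Φ x) (b (Φ x t)) (Set.Icc 0 T) t :=
    fun x hx t ht => ((h1 x hx).2 t (hsub ht)).mono hsub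
  have h0 : ∀ x ∈ Metric.closedBall p0 r, Φ x 0 = x := fun x hx => (h1 x hx).1
  refine ⟨T, hTp, Φ, L, fun x hx => ⟨h0 x hx, hder x hx⟩, fun t ht => h2 t (hsub ht), ?_, ?_, ?_⟩
  · intro t ht x hx y hy
    have m := norm_image_sub_le_of_norm_deriv_le_segment' (f := fun s => Φ x s - Φ y s)
      (C := C * (L * dist x y)) (fun s hs => (hder x hx s hs).sub (hder y hy s hs))
      (fun s hs => by
        rw [← dist_eq_norm]
        refine (hl.dist_le_mul _ _).trans ?_
        refine mul_le_mul_of_nonneg_left ?_ C.2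
        exact (h2 s (hsub (Set.Ico_subset_Icc_self hs))).dist_le_mul x hx y hy) t ht
    rw [h0 x hx, h0 y hy, sub_zero] at m
    have m2 : ‖x - y‖ ≤ ‖Φ x t - Φ y t‖ + ‖Φ x t - Φ y t - (x - y)‖ := by
      have := norm_sub_le (Φ x t - Φ y t) (Φ x t - Φ y t - (x - y))
      simpa using this
    rw [dist_eq_norm, dist_eq_norm]
    rw [dist_eq_norm] at m
    have m3 : C * (L * ‖x - y‖) * t ≤ 1 / 2 * ‖x - y‖ := by
      calc C * (L * ‖x - y‖) * t = (C * L * t) * ‖x - y‖ := by ring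
        _ ≤ (C * L * T) * ‖x - y‖ := by gcongr; exact ht.2
        _ ≤ _ := by gcongr
    linarith
  · intro t ht x hx
    have m := norm_image_sub_le_of_norm_deriv_le_segment' (f := Φ x) (C := C) (hder x hx)
      (fun s hs => hbd _) t ht
    rw [h0 x hx, sub_zero] at m
    rw [dist_eq_norm]
    refine m.trans (le_trans ?_ hCT0)
    exact mul_le_mul_of_nonneg_left (ht.2.trans hTT) C.2
  · exact continuousOn_prod_of_continuousOn_lipschitzOnWith (fun z : (ℝ × ℝ) × ℝ => Φ z.1 z.2) L
      (fun x hx t ht => (hder x hx t ht).continuousWithinAt) (fun t ht => h2 t (hsub ht))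

/-- preimages of null sets under expanding maps are null -/
lemma null_preimage {S N : Set (ℝ × ℝ)} {f : ℝ × ℝ → ℝ × ℝ}
    (hf : ∀ x ∈ S, ∀ y ∈ S, dist x y ≤ 2 * dist (f x) (f y)) (hN : volume N = 0) :
    volume {x | x ∈ S ∧ f x ∈ N} = 0 := by
  set A := {x | x ∈ S ∧ f x ∈ N} with hA
  have hinj : Set.InjOn f A := by
    intro x hx y hy hxy
    have := hf x hx.1 y hy.1
    rw [hxy, dist_self, mul_zero] at this
    exact dist_le_zero.1 this
  have hg : LipschitzOnWith 2 (Function.invFunOn f A) (f '' A) := by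
    rw [lipschitzOnWith_iff_dist_le_mul]
    rintro _ ⟨x, hx, rfl⟩ _ ⟨y, hy, rfl⟩
    rw [hinj.leftInvOn_invFunOn hx, hinj.leftInvOn_invFunOn hy]
    exact hf x hx.1 y hy.1
  have himg : Function.invFunOn f A '' (f '' A) = A := hinj.leftInvOn_invFunOn.image_image
  have h1 := hg.hausdorffMeasure_image_le (d := 2) (by norm_num)
  rw [himg, hausdorffMeasure_prod_real] at h1
  have h2 : volume (f '' A) = 0 := measure_mono_null (by rintro _ ⟨x, hx, rfl⟩; exact hx.2) hN
  rw [h2, mul_zero] at h1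
  exact le_antisymm h1 bot_le

lemma exists_eta : ∃ η : ℝ × ℝ → ℝ, ∃ A : ℝ, 0 ≤ A ∧ ContDiff ℝ (⊤ : ℕ∞) η ∧
    (∀ y, y ∉ Metric.closedBall (0 : ℝ × ℝ) 1 → η y = 0) ∧ (∫ y, η y = 1) ∧
    (∀ y, |η y| ≤ A) ∧ ∀ y, ‖fderiv ℝ η y‖ ≤ A := by
  let f : ContDiffBump (0 : ℝ × ℝ) := ⟨1 / 2, 1, by norm_num, by norm_num⟩
  have hc : HasCompactSupport (f.normed volume) := f.hasCompactSupport_normed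
  have hs : ContDiff ℝ (⊤ : ℕ∞) (f.normed volume) := f.contDiff_normed
  obtain ⟨A1, h1, h1'⟩ := test_bdd hs.continuous hc
  obtain ⟨A2, h2⟩ := (hc.fderiv (𝕜 := ℝ)).exists_bound_of_continuous (hs.continuous_fderiv (by simp))
  refine ⟨f.normed volume, max A1 A2, h1.trans (le_max_left _ _), hs, fun y hy => ?_,
    f.integral_normed, fun y => (h1' y).trans (le_max_left _ _),
    fun y => (h2 y).trans (le_max_right _ _)⟩
  have : y ∉ Function.support (f.normed volume) := by
    rw [f.support_normed_eq]
    exact fun h => hy (Metric.ball_subset_closedBall h)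
  simpa using this

/-- rescaled and recentred mollifier -/
def molk (η : ℝ × ℝ → ℝ) (δ : ℝ) (y : ℝ × ℝ) : ℝ := (δ ^ 2)⁻¹ * η (δ⁻¹ • y)

lemma molk_smooth {η : ℝ × ℝ → ℝ} (h : ContDiff ℝ (⊤ : ℕ∞) η) (δ : ℝ) :
    ContDiff ℝ (⊤ : ℕ∞) (molk η δ) :=
  contDiff_const.mul (h.comp (contDiff_const_smul δ⁻¹))

lemma molk_zero {η : ℝ × ℝ → ℝ} (h : ∀ y, y ∉ Metric.closedBall (0 : ℝ × ℝ) 1 → η y = 0)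
    {δ : ℝ} (hδ : 0 < δ) {y : ℝ × ℝ} (hy : y ∉ Metric.closedBall (0 : ℝ × ℝ) δ) : molk η δ y = 0 := by
  rw [molk, h, mul_zero]
  rw [mem_closedBall_zero_iff, not_le] at hy ⊢
  rw [norm_smul, norm_inv, Real.norm_of_nonneg hδ.le, inv_mul_eq_div, lt_div_iff₀ hδ]
  linarith

lemma molk_int {η : ℝ × ℝ → ℝ} (h : ∫ y, η y = 1) {δ : ℝ} (hδ : 0 < δ) :
    ∫ y, molk η δ y = 1 := by
  simp only [molk]
  rw [integral_const_mul, Measure.integral_comp_smul, h]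
  simp only [Module.finrank_prod, Module.finrank_self, smul_eq_mul, mul_one]
  rw [inv_pow, inv_inv]
  norm_num
  rw [inv_mul_cancel₀ (by positivity)]

lemma molk_fderiv {η : ℝ × ℝ → ℝ} (h : ContDiff ℝ (⊤ : ℕ∞) η) (δ : ℝ) (y : ℝ × ℝ) :
    fderiv ℝ (molk η δ) y = (δ ^ 2)⁻¹ • δ⁻¹ • fderiv ℝ η (δ⁻¹ • y) := by
  have h1 : HasFDerivAt η (fderiv ℝ η (δ⁻¹ • y)) (δ⁻¹ • y) :=
    (h.differentiable (by simp) _).hasFDerivAt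
  have h2 : HasFDerivAt (fun y : ℝ × ℝ => δ⁻¹ • y) (δ⁻¹ • ContinuousLinearMap.id ℝ (ℝ × ℝ)) y :=
    (hasFDerivAt_id y).const_smul δ⁻¹
  have h3 := (h1.comp y h2).const_mul ((δ ^ 2)⁻¹)
  have := h3.fderiv
  refine Eq.trans this ?_
  ext <;> simp

lemma fderiv_refl {f : ℝ × ℝ → ℝ} (h : ContDiff ℝ (⊤ : ℕ∞) f) (x y e : ℝ × ℝ) :
    pdv e (fun y => f (x - y)) y = - pdv e f (x - y) := by
  have h1 : HasFDerivAt f (fderiv ℝ f (x - y)) (x - y) :=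
    (h.differentiable (by simp) _).hasFDerivAt
  have h2 : HasFDerivAt (fun y : ℝ × ℝ => x - y) (-ContinuousLinearMap.id ℝ (ℝ × ℝ)) y :=
    (hasFDerivAt_id y).const_sub x
  have := (h1.comp y h2).fderiv
  simp only [pdv]
  rw [show (fun y => f (x - y)) = f ∘ (fun y => x - y) from rfl, this]
  simp

lemma kernel_est {h k : ℝ × ℝ → ℝ} (hm : Measurable h) (h1 : ∀ y, |h y| ≤ 1)
    (km : AEStronglyMeasurable k volume) {x : ℝ × ℝ} {δ A : ℝ} (hδ : 0 < δ)
    (k0 : ∀ y, y ∉ Metric.closedBall x δ → k y = 0) (kA : ∀ᵐ y, |k y| ≤ A * (δ ^ 2)⁻¹) :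
    |(∫ y, h y * k y) - h x * ∫ y, k y| ≤
      4 * A * ⨍ y in Metric.closedBall x δ, ‖h y - h x‖ := by
  set B := Metric.closedBall x δ with hB
  have hBm : MeasurableSet B := Metric.isClosed_closedBall.measurableSet
  have hvol : volume.real B = 4 * δ ^ 2 := by
    rw [hB, Measure.real, ← closedBall_prod_same, Measure.volume_eq_prod, Measure.prod_prod,
      Real.volume_closedBall, Real.volume_closedBall, ← ENNReal.ofReal_mul (by positivity),
      ENNReal.toReal_ofReal (by positivity)]
    ring
  have hfin : volume B < ⊤ := measure_closedBall_lt_top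
  have : IsFiniteMeasure (volume.restrict B) := ⟨by rwa [Measure.restrict_apply_univ]⟩
  have ik : Integrable k := by
    rw [← integrableOn_iff_integrable_of_support_subset (s := B)]
    · exact Integrable.of_bound km.restrict (A * (δ ^ 2)⁻¹) (ae_restrict_of_ae kA)
    · intro y hy
      by_contra hyB
      exact hy (k0 y hyB)
  have ihk : Integrable (fun y => h y * k y) := by
    refine ik.bdd_mul hm.aestronglyMeasurable (c := 1) (Eventually.of_forall h1)
  rw [← integral_const_mul, ← integral_sub ihk (ik.const_mul _)]
  have e : ∫ y, (h y * k y - h x * k y) = ∫ y in B, (h y - h x) * k y := by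
    rw [setIntegral_eq_integral_of_forall_compl_eq_zero]
    · congr 1; ext y; ring
    · intro y hy; rw [k0 y hy, mul_zero]
  rw [e, setAverage_eq, hvol]
  have idd : Integrable (fun y => ‖h y - h x‖) (volume.restrict B) := by
    refine Integrable.of_bound ?_ 2 (Eventually.of_forall fun y => ?_)
    · exact ((hm.sub_const _).norm).aestronglyMeasurable
    · rw [norm_norm, Real.norm_eq_abs]
      calc |h y - h x| ≤ |h y| + |h x| := abs_sub _ _
        _ ≤ 2 := by linarith [h1 y, h1 x]
  have hle : |∫ y in B, (h y - h x) * k y| ≤ ∫ y in B, (A * (δ ^ 2)⁻¹) * ‖h y - h x‖ := by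
    rw [← Real.norm_eq_abs]
    refine (norm_integral_le_integral_norm _).trans ?_
    refine integral_mono_of_nonneg (Eventually.of_forall fun y => norm_nonneg _) (idd.const_mul _) ?_
    filter_upwards [ae_restrict_of_ae kA] with y hy
    rw [norm_mul, mul_comm]
    exact mul_le_mul_of_nonneg_right hy (norm_nonneg _)
  refine hle.trans (le_of_eq ?_)
  rw [integral_const_mul, smul_eq_mul]
  field_simp

/-- mollification -/
def mol (h κ : ℝ × ℝ → ℝ) (x : ℝ × ℝ) : ℝ := ∫ y, h y * κ (x - y)

lemma mol_C1 {h κ : ℝ × ℝ → ℝ} (hm : Measurable h) (h1 : ∀ y, |h y| ≤ 1)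
    (hκ : ContDiff ℝ (⊤ : ℕ∞) κ) (hc : HasCompactSupport κ) :
    ContDiff ℝ 1 (mol h κ) ∧ ∀ x e, fderiv ℝ (mol h κ) x e = ∫ y, h y * pdv e κ (x - y) := by
  have hl : LocallyIntegrable h volume := by
    have : LocallyIntegrable (fun _ : ℝ × ℝ => (1 : ℝ)) volume := locallyIntegrable_const 1
    exact this.mono hm.aestronglyMeasurable (Eventually.of_forall fun y => by simpa using h1 y)
  have e : mol h κ = convolution h κ (ContinuousLinearMap.mul ℝ ℝ) volume := by
    ext x; simp [mol, convolution_def]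
  have hκ1 : ContDiff ℝ 1 κ := hκ.of_le (by simp)
  refine ⟨?_, fun x v => ?_⟩
  · rw [e]; exact hc.contDiff_convolution_right _ hl hκ1
  · rw [e, (hc.hasFDerivAt_convolution_right _ hl hκ1 x).fderiv,
      convolution_precompR_apply _ hl (hc.fderiv (𝕜 := ℝ)) (hκ1.continuous_fderiv (by simp))]
    simp [convolution_def, pdv]

lemma integ_cs {f : ℝ × ℝ → ℝ} (hf : Measurable f) (x : ℝ × ℝ) (δ M : ℝ) (hM : ∀ y, |f y| ≤ M)
    (h0 : ∀ y, y ∉ Metric.closedBall x δ → f y = 0) : Integrable f := by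
  rw [← integrableOn_iff_integrable_of_support_subset (s := Metric.closedBall x δ)]
  · have : IsFiniteMeasure (volume.restrict (Metric.closedBall x δ)) :=
      ⟨by rw [Measure.restrict_apply_univ]; exact measure_closedBall_lt_top⟩
    exact Integrable.of_bound hf.aestronglyMeasurable M (Eventually.of_forall hM)
  · intro y hy
    by_contra hyB
    exact hy (h0 y hyB)

lemma molk_cs {η : ℝ × ℝ → ℝ} (h : ∀ y, y ∉ Metric.closedBall (0 : ℝ × ℝ) 1 → η y = 0)
    {δ : ℝ} (hδ : 0 < δ) : HasCompactSupport (molk η δ) :=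
  HasCompactSupport.intro (isCompact_closedBall 0 δ) fun _ hy => molk_zero h hδ hy

lemma molk_pdv_zero {η : ℝ × ℝ → ℝ} (h : ∀ y, y ∉ Metric.closedBall (0 : ℝ × ℝ) 1 → η y = 0)
    {δ : ℝ} (hδ : 0 < δ) {y : ℝ × ℝ} (hy : y ∉ Metric.closedBall (0 : ℝ × ℝ) δ) (e : ℝ × ℝ) :
    pdv e (molk η δ) y = 0 := by
  refine pdv_zero_of_notMem fun hh => hy ?_
  refine closure_minimal ?_ Metric.isClosed_closedBall hh
  intro z hz
  by_contra hzz
  exact hz (molk_zero h hδ hzz)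

lemma mol_est {Ω : Set (ℝ × ℝ)} (hΩ : IsOpen Ω) (hb : Bornology.IsBounded Ω)
    {b1 b2 h : ℝ × ℝ → ℝ} {C : NNReal} (l1 : LipschitzWith C b1) (l2 : LipschitzWith C b2)
    (B1 : ∀ y, |b1 y| ≤ C) (B2 : ∀ y, |b2 y| ≤ C)
    (hm : Measurable h) (h1 : ∀ y, |h y| ≤ 1)
    (hw : ∀ φ, IsTest Ω φ → ∫ p in Ω, h p * ((b1 p * pdv (1, 0) φ p + b2 p * pdv (0, 1) φ p) +
      (pdv (1, 0) b1 p + pdv (0, 1) b2 p) * φ p) = 0)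
    {η : ℝ × ℝ → ℝ} {A : ℝ} (hA : 0 ≤ A) (ηs : ContDiff ℝ (⊤ : ℕ∞) η)
    (η0 : ∀ y, y ∉ Metric.closedBall (0 : ℝ × ℝ) 1 → η y = 0) (ηi : ∫ y, η y = 1)
    (ηA : ∀ y, |η y| ≤ A) (ηA' : ∀ y, ‖fderiv ℝ η y‖ ≤ A)
    {x : ℝ × ℝ} {δ : ℝ} (hδ : 0 < δ) (hx : Metric.closedBall x δ ⊆ Ω) :
    |mol h (molk η δ) x - h x| ≤ 4 * A * ⨍ y in Metric.closedBall x δ, ‖h y - h x‖ ∧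
    |fderiv ℝ (mol h (molk η δ)) x (b1 x, b2 x)| ≤
      4 * (4 * C * A) * ⨍ y in Metric.closedBall x δ, ‖h y - h x‖ := by
  set κ := molk η δ with hκ
  have κs : ContDiff ℝ (⊤ : ℕ∞) κ := molk_smooth ηs δ
  have mem : ∀ y, y ∉ Metric.closedBall x δ → x - y ∉ Metric.closedBall (0 : ℝ × ℝ) δ := by
    intro y hy hh
    apply hy
    rw [mem_closedBall_zero_iff] at hh
    rwa [Metric.mem_closedBall, dist_comm, dist_eq_norm]
  have κ0 : ∀ y, y ∉ Metric.closedBall x δ → κ (x - y) = 0 := fun y hy => molk_zero η0 hδ (mem y hy)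
  have κp0 : ∀ e y, y ∉ Metric.closedBall x δ → pdv e κ (x - y) = 0 :=
    fun e y hy => molk_pdv_zero η0 hδ (mem y hy) e
  have κA : ∀ y, |κ y| ≤ A * (δ ^ 2)⁻¹ := by
    intro y
    rw [hκ, molk, abs_mul, abs_of_nonneg (by positivity), mul_comm]
    exact mul_le_mul_of_nonneg_right (ηA _) (by positivity)
  have κpA : ∀ e : ℝ × ℝ, ‖e‖ ≤ 1 → ∀ y, |pdv e κ y| ≤ A * (δ ^ 2)⁻¹ * δ⁻¹ := by
    intro e he y
    have : ‖fderiv ℝ κ y‖ ≤ A * (δ ^ 2)⁻¹ * δ⁻¹ := by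
      rw [hκ, molk_fderiv ηs, norm_smul, norm_smul, Real.norm_of_nonneg (by positivity),
        Real.norm_of_nonneg (by positivity)]
      calc (δ ^ 2)⁻¹ * (δ⁻¹ * ‖fderiv ℝ η (δ⁻¹ • y)‖) ≤ (δ ^ 2)⁻¹ * (δ⁻¹ * A) := by
            gcongr; exact ηA' _
        _ = _ := by ring
    calc |pdv e κ y| ≤ ‖fderiv ℝ κ y‖ * ‖e‖ := (fderiv ℝ κ y).le_opNorm e
      _ ≤ A * (δ ^ 2)⁻¹ * δ⁻¹ * 1 := by gcongr
      _ = _ := mul_one _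
  have hs : Measurable fun y : ℝ × ℝ => x - y := measurable_const.sub measurable_id
  have mκ : Measurable fun y => κ (x - y) := κs.continuous.measurable.comp hs
  have mp : ∀ e, Measurable fun y => pdv e κ (x - y) := fun e => (pdv_meas e κ).comp hs
  have mb1 := l1.continuous.measurable
  have mb2 := l2.continuous.measurable
  have d1 : ∀ y, |pdv (1, 0) b1 y| ≤ C := fun y =>
    pdv_bound isOpen_univ (l1.lipschitzOnWith (s := Set.univ)) (Set.mem_univ y) ne1
  have d2 : ∀ y, |pdv (0, 1) b2 y| ≤ C := fun y =>
    pdv_bound isOpen_univ (l2.lipschitzOnWith (s := Set.univ)) (Set.mem_univ y) ne2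
  constructor
  · have ee := kernel_est (x := x) hm h1 mκ.aestronglyMeasurable hδ κ0
      (Eventually.of_forall fun y => κA _)
    rwa [integral_sub_left_eq_self (f := κ), molk_int ηi hδ, mul_one] at ee
  set k : ℝ × ℝ → ℝ := fun y => (b1 x - b1 y) * pdv (1, 0) κ (x - y) +
    (b2 x - b2 y) * pdv (0, 1) κ (x - y) + (pdv (1, 0) b1 y + pdv (0, 1) b2 y) * κ (x - y) with hk
  have mk : Measurable k :=
    (((measurable_const.sub mb1).mul (mp _)).add ((measurable_const.sub mb2).mul (mp _))).add
      (((pdv_meas _ _).add (pdv_meas _ _)).mul mκ)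
  have k0 : ∀ y, y ∉ Metric.closedBall x δ → k y = 0 := by
    intro y hy
    simp only [hk, κ0 y hy, κp0 _ y hy]; ring
  have kA : ∀ y, |k y| ≤ 4 * C * A * (δ ^ 2)⁻¹ := by
    intro y
    by_cases hy : y ∈ Metric.closedBall x δ
    · have hd : dist x y ≤ δ := by rw [dist_comm]; exact hy
      have q1 : |b1 x - b1 y| ≤ C * δ := by
        rw [← Real.dist_eq]; exact (l1.dist_le_mul x y).trans (by gcongr)
      have q2 : |b2 x - b2 y| ≤ C * δ := by
        rw [← Real.dist_eq]; exact (l2.dist_le_mul x y).trans (by gcongr)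
      calc |k y| ≤ |b1 x - b1 y| * |pdv (1, 0) κ (x - y)| + |b2 x - b2 y| * |pdv (0, 1) κ (x - y)|
            + (|pdv (1, 0) b1 y| + |pdv (0, 1) b2 y|) * |κ (x - y)| := by
            rw [← abs_mul, ← abs_mul]
            refine (abs_add_le _ _).trans (add_le_add (abs_add_le _ _) ?_)
            rw [abs_mul]
            exact mul_le_mul_of_nonneg_right (abs_add_le _ _) (abs_nonneg _)
        _ ≤ (C * δ) * (A * (δ ^ 2)⁻¹ * δ⁻¹) + (C * δ) * (A * (δ ^ 2)⁻¹ * δ⁻¹)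
            + (C + C) * (A * (δ ^ 2)⁻¹) := by
            gcongr
            · exact κpA _ ne1 _
            · exact κpA _ ne2 _
            · exact d1 y
            · exact d2 y
            · exact κA _
        _ = _ := by field_simp; ring
    · rw [k0 y hy, abs_zero]; positivity
  have ee := kernel_est (x := x) hm h1 mk.aestronglyMeasurable hδ k0 (Eventually.of_forall kA)
  have Ks : ContDiff ℝ (⊤ : ℕ∞) fun y => κ (x - y) := κs.comp (contDiff_const.sub contDiff_id)
  have Kts : tsupport (fun y => κ (x - y)) ⊆ Metric.closedBall x δ := by
    refine closure_minimal ?_ Metric.isClosed_closedBall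
    intro z hz
    by_contra hzz
    exact hz (κ0 z hzz)
  have Kc : HasCompactSupport fun y => κ (x - y) :=
    HasCompactSupport.intro (isCompact_closedBall x δ) κ0
  have Kt : IsTest Ω fun y => κ (x - y) := ⟨Ks, Kc, Kts.trans hx⟩
  have off : ∀ y, y ∉ Ω → y ∉ Metric.closedBall x δ := fun y hy hh => hy (hx hh)
  have ik : ∫ y, k y = 0 := by
    have w := div_form hΩ hb (smooth_locLip Ks) Kc (Kts.trans hx)
      (G1 := fun y => b1 y - b1 x) (G2 := fun y => b2 y - b2 x)
      (lipOn_locLip ((l1.sub (LipschitzWith.const (b1 x))).lipschitzOnWith))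
      (lipOn_locLip ((l2.sub (LipschitzWith.const (b2 x))).lipschitzOnWith))
    rw [← setIntegral_eq_integral_of_forall_compl_eq_zero fun y hy => k0 y (off y hy)]
    refine Eq.trans ?_ w
    congr 1; ext y
    rw [fderiv_refl κs, fderiv_refl κs]
    simp only [hk, pdv, fderiv_sub_const]
    ring
  have key : fderiv ℝ (mol h κ) x (b1 x, b2 x) = ∫ y, h y * k y := by
    rw [(mol_C1 hm h1 κs (molk_cs η0 hδ)).2]
    have w := hw _ Kt
    simp only [fderiv_refl κs] at w
    rw [setIntegral_eq_integral_of_forall_compl_eq_zero] at w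
    swap
    · intro y hy
      rw [κ0 y (off y hy), κp0 _ y (off y hy), κp0 _ y (off y hy)]; ring
    have lin : ∀ y, pdv (b1 x, b2 x) κ y = b1 x * pdv (1, 0) κ y + b2 x * pdv (0, 1) κ y := by
      intro y
      have : ((b1 x, b2 x) : ℝ × ℝ) = b1 x • (1, 0) + b2 x • (0, 1) := by simp
      simp only [pdv]
      rw [this, map_add, map_smul, map_smul, smul_eq_mul, smul_eq_mul]
    have i1 : Integrable fun y => h y * pdv (b1 x, b2 x) κ (x - y) := by
      refine integ_cs (hm.mul (mp _)) x δ (1 * (C * (A * (δ ^ 2)⁻¹ * δ⁻¹) + C * (A * (δ ^ 2)⁻¹ * δ⁻¹)))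
        (fun y => ?_) (fun y hy => by rw [κp0 _ y hy, mul_zero])
      rw [abs_mul, lin]
      refine mul_le_mul (h1 y) ((abs_add_le _ _).trans ?_) (abs_nonneg _) zero_le_one
      rw [abs_mul, abs_mul]
      gcongr
      · exact B1 x
      · exact κpA _ ne1 _
      · exact B2 x
      · exact κpA _ ne2 _
    have ihk : Integrable fun y => h y * k y := by
      refine integ_cs (hm.mul mk) x δ (1 * (4 * C * A * (δ ^ 2)⁻¹)) (fun y => ?_)
        (fun y hy => by rw [k0 y hy, mul_zero])
      rw [abs_mul]
      exact mul_le_mul (h1 y) (kA y) (abs_nonneg _) zero_le_one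
    rw [← sub_eq_zero, ← neg_eq_zero, neg_sub, ← integral_sub ihk i1]
    refine Eq.trans ?_ w
    congr 1; ext y
    rw [lin]; simp only [hk]; ring
  rw [ik, mul_zero, sub_zero, ← key] at ee
  exact ee

/-- The good-point statement for mollifications of bounded weak solutions. -/
lemma mol_main {Ω : Set (ℝ × ℝ)} (hΩ : IsOpen Ω) (hb : Bornology.IsBounded Ω)
    {b1 b2 h : ℝ × ℝ → ℝ} {C : NNReal} (l1 : LipschitzWith C b1) (l2 : LipschitzWith C b2)
    (B1 : ∀ y, |b1 y| ≤ C) (B2 : ∀ y, |b2 y| ≤ C)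
    (hm : Measurable h) (h1 : ∀ y, |h y| ≤ 1)
    (hw : ∀ φ, IsTest Ω φ → ∫ p in Ω, h p * ((b1 p * pdv (1, 0) φ p + b2 p * pdv (0, 1) φ p) +
      (pdv (1, 0) b1 p + pdv (0, 1) b2 p) * φ p) = 0)
    {p0 : ℝ × ℝ} {R δ0 : ℝ} (hδ0 : 0 < δ0) (hR : Metric.closedBall p0 (R + δ0) ⊆ Ω) :
    ∃ H : ℕ → ℝ × ℝ → ℝ, ∃ M : ℝ, (∀ n, ContDiff ℝ 1 (H n)) ∧
      (∀ n, ∀ x ∈ Metric.closedBall p0 R, |fderiv ℝ (H n) x (b1 x, b2 x)| ≤ M) ∧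
      ∀ᵐ x, x ∈ Metric.closedBall p0 R → Tendsto (fun n => H n x) atTop (𝓝 (h x)) ∧
        Tendsto (fun n => fderiv ℝ (H n) x (b1 x, b2 x)) atTop (𝓝 0) := by
  obtain ⟨η, A, hA, ηs, η0, ηi, ηA, ηA'⟩ := exists_eta
  have dpos : ∀ n : ℕ, 0 < δ0 / (n + 1) := fun n => by positivity
  have dle : ∀ n : ℕ, δ0 / (n + 1) ≤ δ0 := fun n => div_le_self hδ0.le (by
    have : (0 : ℝ) ≤ n := Nat.cast_nonneg n
    linarith)
  have sub : ∀ (n : ℕ), ∀ x ∈ Metric.closedBall p0 R, Metric.closedBall x (δ0 / (n + 1)) ⊆ Ω := by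
    intro n x hx
    refine (Metric.closedBall_subset_closedBall' ?_).trans hR
    have := dle n
    rw [Metric.mem_closedBall] at hx
    linarith
  have est := fun (n : ℕ) x (hx : x ∈ Metric.closedBall p0 R) =>
    mol_est hΩ hb l1 l2 B1 B2 hm h1 hw hA ηs η0 ηi ηA ηA' (dpos n) (sub n x hx)
  have hl : LocallyIntegrable h volume := by
    have : LocallyIntegrable (fun _ : ℝ × ℝ => (1 : ℝ)) volume := locallyIntegrable_const 1
    exact this.mono hm.aestronglyMeasurable (Eventually.of_forall fun y => by simpa using h1 y)
  refine ⟨fun n => mol h (molk η (δ0 / (n + 1))), 4 * (4 * C * A) * 2, fun n =>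
    (mol_C1 hm h1 (molk_smooth ηs _) (molk_cs η0 (dpos n))).1, fun n x hx => ?_, ?_⟩
  · refine (est n x hx).2.trans ?_
    refine mul_le_mul_of_nonneg_left ?_ (by positivity)
    set B := Metric.closedBall x (δ0 / (n + 1))
    have hfin : volume B < ⊤ := measure_closedBall_lt_top
    have hpos : 0 < volume B := Metric.measure_closedBall_pos volume x (dpos n)
    have : IsFiniteMeasure (volume.restrict B) := ⟨by rwa [Measure.restrict_apply_univ]⟩
    have h2 : ∀ y, |h y - h x| ≤ 2 := fun y => by
      calc |h y - h x| ≤ |h y| + |h x| := abs_sub _ _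
        _ ≤ 2 := by linarith [h1 y, h1 x]
    have : ∫ y in B, ‖h y - h x‖ ≤ ∫ y in B, (2 : ℝ) := by
      refine integral_mono_of_nonneg (Eventually.of_forall fun y => norm_nonneg _)
        (integrable_const _) (Eventually.of_forall h2)
    rw [setAverage_eq, smul_eq_mul]
    rw [setIntegral_const, smul_eq_mul] at this
    have vp : 0 < volume.real B := ENNReal.toReal_pos hpos.ne' hfin.ne
    rw [inv_mul_le_iff₀ vp]
    exact this
  · filter_upwards [IsUnifLocDoublingMeasure.ae_tendsto_average_norm_sub volume hl 1] with x hx hxR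
    have dlim : Tendsto (fun n : ℕ => δ0 / (n + 1)) atTop (𝓝[>] (0 : ℝ)) := by
      refine tendsto_nhdsWithin_iff.2 ⟨?_, Eventually.of_forall dpos⟩
      have := (tendsto_one_div_add_atTop_nhds_zero_nat (𝕜 := ℝ)).const_mul δ0
      simpa [div_eq_mul_inv] using this
    have hav := hx (fun _ : ℕ => x) (fun n : ℕ => δ0 / (n + 1)) dlim (Eventually.of_forall fun n => by
      rw [one_mul]; exact Metric.mem_closedBall_self (dpos n).le)
    constructor
    · rw [tendsto_iff_dist_tendsto_zero]
      refine squeeze_zero (fun _ => dist_nonneg) (fun n => (est n x hxR).1) ?_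
      simpa using hav.const_mul (4 * A)
    · rw [tendsto_zero_iff_abs_tendsto_zero]
      refine squeeze_zero (fun _ => abs_nonneg _) (fun n => (est n x hxR).2) ?_
      simpa using hav.const_mul (4 * (4 * C * A))

lemma ae_orbit {p0 : ℝ × ℝ} {r T : ℝ} {Φ : ℝ × ℝ → ℝ → ℝ × ℝ}
    (hd : ∀ t ∈ Set.Icc 0 T, ∀ x ∈ Metric.closedBall p0 r, ∀ y ∈ Metric.closedBall p0 r,
        dist x y ≤ 2 * dist (Φ x t) (Φ y t))
    (hc : ContinuousOn (fun z : (ℝ × ℝ) × ℝ => Φ z.1 z.2)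
      (Metric.closedBall p0 r ×ˢ Set.Icc 0 T))
    {N : Set (ℝ × ℝ)} (hN : volume N = 0) :
    ∀ᵐ x : ℝ × ℝ, x ∈ Metric.closedBall p0 r → ∀ᵐ t : ℝ, t ∈ Set.Icc 0 T → Φ x t ∉ N := by
  obtain ⟨N', hNN, hNm, hN'⟩ := exists_measurable_superset_of_null hN
  set S := Metric.closedBall p0 r ×ˢ Set.Icc 0 T with hS
  have hSm : MeasurableSet S := Metric.isClosed_closedBall.measurableSet.prod measurableSet_Icc
  have hm : MeasurableSet {z : (ℝ × ℝ) × ℝ | ¬ (z ∈ S ∧ Φ z.1 z.2 ∈ N')} := by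
    have h1 := hSm.subtype_image ((continuousOn_iff_continuous_domRestrict.1 hc).measurable hNm)
    refine MeasurableSet.compl (s := {z : (ℝ × ℝ) × ℝ | z ∈ S ∧ Φ z.1 z.2 ∈ N'}) ?_
    convert h1 using 1
    refine Set.ext fun z => ?_
    constructor
    · rintro ⟨h1, h2⟩
      exact ⟨⟨z, h1⟩, h2, rfl⟩
    · rintro ⟨⟨z', h1⟩, h2, rfl⟩
      exact ⟨h1, h2⟩
  have key : ∀ᵐ x : ℝ × ℝ, ∀ᵐ t : ℝ, ¬ ((x, t) ∈ S ∧ Φ x t ∈ N') := by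
    rw [Measure.ae_ae_comm (p := fun x t => ¬ ((x, t) ∈ S ∧ Φ x t ∈ N')) hm]
    refine Eventually.of_forall fun t => ?_
    by_cases ht : t ∈ Set.Icc 0 T
    · have := null_preimage (S := Metric.closedBall p0 r) (f := fun x => Φ x t)
        (fun x hx y hy => hd t ht x hx y hy) hN'
      refine measure_mono_null ?_ this
      intro x hx
      simp only [Set.mem_compl_iff, Set.mem_ofPred_eq, not_not] at hx
      exact ⟨hx.1.1, hx.2⟩
    · exact Eventually.of_forall fun x hx => ht hx.1.2
  filter_upwards [key] with x hx hxr
  filter_upwards [hx] with t ht htT hN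
  exact ht ⟨⟨hxr, htT⟩, hNN hN⟩

lemma orbit_affine {Ω : Set (ℝ × ℝ)} {p0 : ℝ × ℝ} {R T M : ℝ} (hT : 0 < T)
    (hR : Metric.closedBall p0 R ⊆ Ω)
    {b : ℝ × ℝ → ℝ × ℝ} {C : NNReal} (hl : LipschitzWith C b) (hbd : ∀ x, ‖b x‖ ≤ C)
    {u : ℝ × ℝ → ℝ} {K : NNReal} (hu : LipschitzOnWith K u Ω)
    {H : ℕ → ℝ × ℝ → ℝ} (H1 : ∀ n, ContDiff ℝ 1 (H n))
    (HM : ∀ n, ∀ x ∈ Metric.closedBall p0 R, |fderiv ℝ (H n) x (b x)| ≤ M)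
    {γ : ℝ → ℝ × ℝ} (hγ : ∀ t ∈ Set.Icc 0 T, HasDerivWithinAt γ (b (γ t)) (Set.Icc 0 T) t)
    (hγR : ∀ t ∈ Set.Icc 0 T, γ t ∈ Metric.closedBall p0 R)
    (good : ∀ᵐ t : ℝ, t ∈ Set.Icc 0 T → DifferentiableAt ℝ u (γ t) ∧
      Tendsto (fun n => H n (γ t)) atTop (𝓝 (Fn (fderiv ℝ u (γ t) (b (γ t))))) ∧
      Tendsto (fun n => fderiv ℝ (H n) (γ t) (b (γ t))) atTop (𝓝 0)) :
    ∀ t ∈ Set.Icc 0 T, T * (u (γ t) - u (γ 0)) = t * (u (γ T) - u (γ 0)) := by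
  have γc : ContinuousOn γ (Set.Icc 0 T) := fun t ht => (hγ t ht).continuousWithinAt
  have γat : ∀ t ∈ Set.Ioo 0 T, HasDerivAt γ (b (γ t)) t := fun t ht =>
    (hγ t ⟨ht.1.le, ht.2.le⟩).hasDerivAt (Icc_mem_nhds ht.1 ht.2)
  -- differences of mollified values tend to zero
  have lim0 : ∀ t ∈ Set.Icc 0 T, Tendsto (fun n => H n (γ t) - H n (γ 0)) atTop (𝓝 0) := by
    intro t ht
    have hsub : Set.Icc 0 t ⊆ Set.Icc 0 T := Set.Icc_subset_Icc_right ht.2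
    have fc : ∀ n, ContinuousOn (fun s => fderiv ℝ (H n) (γ s) (b (γ s))) (Set.Icc 0 t) := by
      intro n
      have a1 : ContinuousOn (fun s => fderiv ℝ (H n) (γ s)) (Set.Icc 0 t) :=
        ((H1 n).continuous_fderiv (by simp)).comp_continuousOn (γc.mono hsub)
      have a2 : ContinuousOn (fun s => b (γ s)) (Set.Icc 0 t) :=
        hl.continuous.comp_continuousOn (γc.mono hsub)
      exact a1.clm_apply a2
    have fi : ∀ n, IntervalIntegrable (fun s => fderiv ℝ (H n) (γ s) (b (γ s))) volume 0 t := by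
      intro n
      apply ContinuousOn.intervalIntegrable
      rw [Set.uIcc_of_le ht.1]
      exact fc n
    have eq : ∀ n, ∫ s in (0 : ℝ)..t, fderiv ℝ (H n) (γ s) (b (γ s)) = H n (γ t) - H n (γ 0) := by
      intro n
      refine intervalIntegral.integral_eq_sub_of_hasDerivAt_of_le (f := fun s => H n (γ s)) ht.1
        ((H1 n).continuous.comp_continuousOn (γc.mono hsub)) (fun s hs => ?_) (fi n)
      exact (((H1 n).differentiable (by simp) _).hasFDerivAt).comp_hasDerivAt s
        (γat s ⟨hs.1, hs.2.trans_le ht.2⟩)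
    simp_rw [← eq]
    have := intervalIntegral.tendsto_integral_filter_of_dominated_convergence (μ := volume)
      (a := 0) (b := t) (l := atTop) (F := fun n s => fderiv ℝ (H n) (γ s) (b (γ s)))
      (f := fun _ => (0 : ℝ)) (fun _ => M) ?_ ?_ ?_ ?_
    · simpa using this
    · exact Eventually.of_forall fun n => (fi n).aestronglyMeasurable_restrict_uIoc
    · refine Eventually.of_forall fun n => Eventually.of_forall fun s hs => ?_
      rw [Set.uIoc_of_le ht.1] at hs
      exact HM n _ (hγR s ⟨hs.1.le, hs.2.trans ht.2⟩)
    · exact intervalIntegrable_const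
    · filter_upwards [good] with s hs hst
      rw [Set.uIoc_of_le ht.1] at hst
      exact (hs ⟨hst.1.le, hst.2.trans ht.2⟩).2.2
  -- pick a good time
  obtain ⟨t0, ht0, g0⟩ : ∃ t0, t0 ∈ Set.Icc 0 T ∧ (t0 ∈ Set.Icc 0 T → DifferentiableAt ℝ u (γ t0) ∧
      Tendsto (fun n => H n (γ t0)) atTop (𝓝 (Fn (fderiv ℝ u (γ t0) (b (γ t0))))) ∧
      Tendsto (fun n => fderiv ℝ (H n) (γ t0) (b (γ t0))) atTop (𝓝 0)) := by
    by_contra hcon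
    push Not at hcon
    have : volume (Set.Icc 0 T) = 0 := by
      refine measure_mono_null ?_ good
      intro t ht hh
      obtain ⟨h1, h2⟩ := hcon t ht
      obtain ⟨q1, q2, q3⟩ := hh ht
      exact h2 q1 q2 q3
    rw [Real.volume_Icc, ENNReal.ofReal_eq_zero] at this
    linarith
  set d := fderiv ℝ u (γ t0) (b (γ t0)) with hd
  have lim : Tendsto (fun n => H n (γ 0)) atTop (𝓝 (Fn d)) := by
    have := (g0 ht0).2.1.sub (lim0 t0 ht0)
    simpa using this
  set w : ℝ → ℝ := fun t => u (γ t) with hw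
  have wd : ∀ᵐ t : ℝ, t ∈ Set.Ioo 0 T → deriv w t = d := by
    filter_upwards [good] with t ht htT
    obtain ⟨q1, q2, -⟩ := ht ⟨htT.1.le, htT.2.le⟩
    have h1 : Tendsto (fun n => H n (γ t)) atTop (𝓝 (Fn d)) := by
      have := (lim0 t ⟨htT.1.le, htT.2.le⟩).add lim
      simpa using this
    have h2 := Fn_mono.injective (tendsto_nhds_unique q2 h1)
    rw [← h2]
    exact (q1.hasFDerivAt.comp_hasDerivAt t (γat t htT)).deriv
  have γl : LipschitzOnWith C γ (Set.Icc 0 T) :=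
    (convex_Icc 0 T).lipschitzOnWith_of_nnnorm_hasDerivWithin_le hγ fun t _ => hbd _
  have wl : LipschitzOnWith (K * C) w (Set.Icc 0 T) :=
    hu.comp γl fun t ht => hR (hγR t ht)
  have aff : ∀ t ∈ Set.Icc 0 T, w t - w 0 = t * d := by
    intro t ht
    have hsub : Set.Icc 0 t ⊆ Set.Icc 0 T := Set.Icc_subset_Icc_right ht.2
    have ac : AbsolutelyContinuousOnInterval w 0 t := by
      apply LipschitzOnWith.absolutelyContinuousOnInterval (K := K * C)
      rw [Set.uIcc_of_le ht.1]
      exact wl.mono hsub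
    rw [← ac.integral_deriv_eq_sub, intervalIntegral.integral_congr_ae (g := fun _ => d)]
    · simp
    · have hTne : ∀ᵐ s : ℝ, s ≠ T := by simp [ae_iff]
      filter_upwards [wd, hTne] with s hs hsT hst
      rw [Set.uIoc_of_le ht.1] at hst
      exact hs ⟨hst.1, lt_of_le_of_ne (hst.2.trans ht.2) hsT⟩
  intro t ht
  change T * (w t - w 0) = t * (w T - w 0)
  rw [aff t ht, aff T ⟨hT.le, le_rfl⟩]
  ring

lemma fderiv_coord {f : ℝ × ℝ → ℝ} (p : ℝ × ℝ) (a b : ℝ) :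
    fderiv ℝ f p (a, b) = a * pdv (1, 0) f p + b * pdv (0, 1) f p := by
  have : ((a, b) : ℝ × ℝ) = a • (1, 0) + b • (0, 1) := by simp
  simp only [pdv]
  rw [this, map_add, map_smul, map_smul, smul_eq_mul, smul_eq_mul]

lemma stage2 {Ω : Set (ℝ × ℝ)} (hΩ : IsOpen Ω) (hb : Bornology.IsBounded Ω)
    {b1 b2 u : ℝ × ℝ → ℝ} {C K : NNReal} (l1 : LipschitzWith C b1) (l2 : LipschitzWith C b2)
    (B1 : ∀ y, |b1 y| ≤ C) (B2 : ∀ y, |b2 y| ≤ C) (hu : LipschitzOnWith K u Ω)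
    (hw : ∀ φ, IsTest Ω φ → ∫ p in Ω, Fn (b1 p * pdv (1, 0) u p + b2 p * pdv (0, 1) u p) *
      ((b1 p * pdv (1, 0) φ p + b2 p * pdv (0, 1) φ p) +
      (pdv (1, 0) b1 p + pdv (0, 1) b2 p) * φ p) = 0)
    {p0 : ℝ × ℝ} (hp0 : p0 ∈ Ω) :
    ∃ r > 0, ∃ c : ℝ × ℝ → ℝ, ∃ L : NNReal, Metric.ball p0 r ⊆ Ω ∧
      LipschitzOnWith L c (Metric.ball p0 r) ∧
      ∀ p ∈ Metric.ball p0 r, DifferentiableAt ℝ u p →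
        b1 p * pdv (1, 0) u p + b2 p * pdv (0, 1) u p = c p := by
  obtain ⟨ρ, ρpos, hρ⟩ := Metric.nhds_basis_closedBall.mem_iff.1 (hΩ.mem_nhds hp0)
  set r := ρ / 4 with hr
  have rpos : 0 < r := by positivity
  have hR : Metric.closedBall p0 (2 * r + r) ⊆ Ω :=
    (Metric.closedBall_subset_closedBall (by rw [hr]; linarith)).trans hρ
  set b : ℝ × ℝ → ℝ × ℝ := fun p => (b1 p, b2 p) with hbdef
  have hl : LipschitzWith C b := by
    have := l1.prodMk l2
    rwa [max_self] at this
  have hbd : ∀ x, ‖b x‖ ≤ C := fun x => by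
    rw [Prod.norm_def]; exact max_le (B1 x) (B2 x)
  obtain ⟨T, hT, Φ, L, f1, f2, f3, f4, f5⟩ := flow hl hbd p0 rpos
  have hm : Measurable fun p => Fn (b1 p * pdv (1, 0) u p + b2 p * pdv (0, 1) u p) :=
    Fn_cont.measurable.comp ((l1.continuous.measurable.mul (pdv_meas _ _)).add
      (l2.continuous.measurable.mul (pdv_meas _ _)))
  obtain ⟨H, M, H1, HM, Hae⟩ := mol_main hΩ hb l1 l2 B1 B2 hm (fun y => Fn_abs _) hw rpos hR
  have sub2 : Metric.closedBall p0 (2 * r) ⊆ Ω :=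
    (Metric.closedBall_subset_closedBall (by linarith)).trans hR
  have stay : ∀ x ∈ Metric.closedBall p0 r, ∀ t ∈ Set.Icc 0 T,
      Φ x t ∈ Metric.closedBall p0 (2 * r) := by
    intro x hx t ht
    have h1 := f4 t ht x hx
    rw [Metric.mem_closedBall] at hx ⊢
    linarith [dist_triangle (Φ x t) x p0]
  have hdiff := (ae_restrict_iff' hΩ.measurableSet).1 (ae_diff hΩ (lipOn_locLip hu))
  have hgood := ae_orbit f3 f5 (ae_iff.1 (hdiff.and Hae))
  have affae : ∀ᵐ x : ℝ × ℝ, x ∈ Metric.closedBall p0 r → ∀ t ∈ Set.Icc 0 T,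
      T * (u (Φ x t) - u (Φ x 0)) = t * (u (Φ x T) - u (Φ x 0)) := by
    filter_upwards [hgood] with x hx hxr
    refine orbit_affine hT sub2 hl hbd hu H1 HM (f1 x hxr).2 (stay x hxr) ?_
    filter_upwards [hx hxr] with t ht htT
    have q := ht htT
    simp only [not_not] at q
    obtain ⟨q1, q2⟩ := q
    obtain ⟨q3, q4⟩ := q2 (stay x hxr t htT)
    refine ⟨q1 (sub2 (stay x hxr t htT)), ?_, q4⟩
    rw [hbdef, fderiv_coord]
    exact q3
  have T0 : (0 : ℝ) ∈ Set.Icc 0 T := ⟨le_rfl, hT.le⟩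
  have TT : T ∈ Set.Icc 0 T := ⟨hT.le, le_rfl⟩
  have bsub : Metric.ball p0 r ⊆ Metric.closedBall p0 r := Metric.ball_subset_closedBall
  have lipc : ∀ t ∈ Set.Icc 0 T, LipschitzOnWith (K * L) (fun x => u (Φ x t)) (Metric.ball p0 r) :=
    fun t ht => hu.comp ((f2 t ht).mono bsub) fun x hx => sub2 (stay x (bsub hx) t ht)
  have aff : ∀ x ∈ Metric.ball p0 r, ∀ t ∈ Set.Icc 0 T,
      T * (u (Φ x t) - u (Φ x 0)) = t * (u (Φ x T) - u (Φ x 0)) := by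
    intro x hx t ht
    have hae : (fun x => T * (u (Φ x t) - u (Φ x 0))) =ᵐ[volume.restrict (Metric.ball p0 r)]
        (fun x => t * (u (Φ x T) - u (Φ x 0))) := by
      rw [Filter.EventuallyEq, ae_restrict_iff' Metric.isOpen_ball.measurableSet]
      filter_upwards [affae] with y hy hyr
      exact hy (bsub hyr) t ht
    exact Measure.eqOn_open_of_ae_eq hae Metric.isOpen_ball
      (continuousOn_const.mul ((lipc t ht).continuousOn.sub (lipc 0 T0).continuousOn))
      (continuousOn_const.mul ((lipc T TT).continuousOn.sub (lipc 0 T0).continuousOn)) hx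
  refine ⟨r, rpos, fun x => T⁻¹ * (u (Φ x T) - u (Φ x 0)), ‖T⁻¹‖₊ * (K * L + K * L), fun x hx => sub2
    (Metric.closedBall_subset_closedBall (by linarith) (bsub hx)), ?_, ?_⟩
  · exact (lipschitzWith_smul T⁻¹).comp_lipschitzOnWith ((lipc T TT).sub (lipc 0 T0))
  · intro p hp hd
    rw [← fderiv_coord]
    have e0 : Φ p 0 = p := (f1 p (bsub hp)).1
    have h1 : HasDerivWithinAt (fun t => u (Φ p t)) (fderiv ℝ u p (b1 p, b2 p)) (Set.Icc 0 T) 0 := by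
      have h2 := (f1 p (bsub hp)).2 0 T0
      rw [e0] at h2
      have h3 : HasFDerivAt u (fderiv ℝ u p) (Φ p 0) := by rw [e0]; exact hd.hasFDerivAt
      exact h3.comp_hasDerivWithinAt 0 h2
    have h4 : HasDerivWithinAt (fun t => u (Φ p t)) (T⁻¹ * (u (Φ p T) - u (Φ p 0)))
        (Set.Icc 0 T) 0 := by
      have h5 : HasDerivWithinAt (fun t => u (Φ p 0) + t * (T⁻¹ * (u (Φ p T) - u (Φ p 0))))
          (T⁻¹ * (u (Φ p T) - u (Φ p 0))) (Set.Icc 0 T) 0 := by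
        have := ((hasDerivAt_id (0 : ℝ)).mul_const (T⁻¹ * (u (Φ p T) - u (Φ p 0)))).const_add
          (u (Φ p 0))
        rw [one_mul] at this
        exact this.hasDerivWithinAt
      refine h5.congr_of_mem (fun t ht => ?_) T0
      have := aff p hp t ht
      field_simp
      linarith
    exact (uniqueDiffOn_Icc hT 0 T0).eq_deriv _ h1 h4

lemma lip_ext {Ω : Set (ℝ × ℝ)} {f : ℝ × ℝ → ℝ} {C : NNReal} (hf : LipschitzOnWith C f Ω)
    (hb : ∀ p ∈ Ω, |f p| ≤ (C : ℝ)) :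
    ∃ g : ℝ × ℝ → ℝ, LipschitzWith C g ∧ (∀ p, |g p| ≤ (C : ℝ)) ∧ ∀ p ∈ Ω, f p = g p := by
  obtain ⟨g, hg, hfg⟩ := hf.extend_real
  refine ⟨fun p => max (-(C : ℝ)) (min (C : ℝ) (g p)), (hg.const_min _).const_max _, fun p => ?_, fun p hp => ?_⟩
  · rw [abs_le]
    refine ⟨le_max_left _ _, max_le ?_ (min_le_left _ _)⟩
    have : (0 : ℝ) ≤ C := C.2
    linarith
  · have := abs_le.1 (hb p hp)
    beta_reduce
    rw [← hfg hp, min_eq_right this.2, max_eq_right this.1]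

lemma glue {Ω : Set (ℝ × ℝ)} (hΩ : IsOpen Ω) {v u : ℝ × ℝ → ℝ}
    (hd : ∀ᵐ p : ℝ × ℝ, p ∈ Ω → DifferentiableAt ℝ u p)
    (h : ∀ p0 ∈ Ω, ∃ r > 0, ∃ c : ℝ × ℝ → ℝ, ∃ L : NNReal, Metric.ball p0 r ⊆ Ω ∧
      LipschitzOnWith L c (Metric.ball p0 r) ∧
      ∀ p ∈ Metric.ball p0 r, DifferentiableAt ℝ u p → v p = c p) :
    ∃ g : ℝ × ℝ → ℝ, LocallyLipschitzOn Ω g ∧ ∀ p ∈ Ω, DifferentiableAt ℝ u p → g p = v p := by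
  set D : Set (ℝ × ℝ) := {p | p ∈ Ω → DifferentiableAt ℝ u p} with hD
  have dense : Dense D := Measure.dense_of_ae hd
  have key : ∀ p0 ∈ Ω, ∃ r > 0, ∃ c : ℝ × ℝ → ℝ, ∃ L : NNReal,
      LipschitzOnWith L c (Metric.ball p0 r) ∧
      (∀ p ∈ Metric.ball p0 r, extendFrom D v p = c p) ∧
      ∀ p ∈ Metric.ball p0 r, DifferentiableAt ℝ u p → v p = c p := by
    intro p0 hp0
    obtain ⟨r, hr, c, L, hs, hL, hc⟩ := h p0 hp0
    refine ⟨r, hr, c, L, hL, fun p hp => extendFrom_eq (dense p) ?_, hc⟩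
    have cc : ContinuousAt c p := hL.continuousOn.continuousAt (Metric.isOpen_ball.mem_nhds hp)
    refine Tendsto.congr' ?_ (cc.mono_left nhdsWithin_le_nhds)
    filter_upwards [self_mem_nhdsWithin, nhdsWithin_le_nhds (Metric.isOpen_ball.mem_nhds hp)]
      with q hq hqb
    exact (hc q hqb (hq (hs hqb))).symm
  refine ⟨extendFrom D v, fun p hp => ?_, fun p hp hdp => ?_⟩
  · obtain ⟨r, hr, c, L, hL, he, -⟩ := key p hp
    refine ⟨L, Metric.ball p r, nhdsWithin_le_nhds (Metric.ball_mem_nhds p hr), ?_⟩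
    intro x hx y hy
    rw [he x hx, he y hy]
    exact hL hx hy
  · obtain ⟨r, hr, c, L, hL, he, hc⟩ := key p hp
    rw [he p (Metric.mem_ball_self hr), hc p (Metric.mem_ball_self hr) hdp]

lemma lip_integ {Ω : Set (ℝ × ℝ)} (hΩ : IsOpen Ω) {w : ℝ × ℝ → ℝ} (hw : LocallyLipschitzOn Ω w)
    (hc : HasCompactSupport w) (ht : tsupport w ⊆ Ω) : Integrable w (volume.restrict Ω) := by
  obtain ⟨C, hC⟩ := lip_of_compact hΩ hw hc ht
  exact (hC.continuous.integrable_of_hasCompactSupport hc).restrict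

lemma integ_bmul {μ : Measure (ℝ × ℝ)} {b f : ℝ × ℝ → ℝ} {C : ℝ} (hb : Measurable b)
    (hbd : ∀ p, |b p| ≤ C) (hf : Integrable f μ) : Integrable (fun p => b p * f p) μ :=
  hf.bdd_mul hb.aestronglyMeasurable (c := C) (Eventually.of_forall hbd)

lemma wk {Ω : Set (ℝ × ℝ)} (hΩ : IsOpen Ω) (hb : Bornology.IsBounded Ω)
    {b1 b2 f φ : ℝ × ℝ → ℝ} {C : NNReal} (l1 : LipschitzWith C b1) (l2 : LipschitzWith C b2)
    (B1 : ∀ y, |b1 y| ≤ C) (B2 : ∀ y, |b2 y| ≤ C) (hf : LocallyLipschitzOn Ω f)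
    (hφ : IsTest Ω φ) :
    ∫ p in Ω, (b1 p * pdv (1, 0) f p + b2 p * pdv (0, 1) f p) * φ p =
      -∫ p in Ω, f p * ((b1 p * pdv (1, 0) φ p + b2 p * pdv (0, 1) φ p) +
        (pdv (1, 0) b1 p + pdv (0, 1) b2 p) * φ p) := by
  obtain ⟨φs, φc, φt⟩ := hφ
  have hφl : LocallyLipschitzOn Ω φ := smooth_locLip φs
  have m1 := l1.continuous.measurable
  have m2 := l2.continuous.measurable
  have d1 : ∀ y, |pdv (1, 0) b1 y| ≤ C := fun y =>
    pdv_bound isOpen_univ (l1.lipschitzOnWith (s := Set.univ)) (Set.mem_univ y) ne1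
  have d2 : ∀ y, |pdv (0, 1) b2 y| ≤ C := fun y =>
    pdv_bound isOpen_univ (l2.lipschitzOnWith (s := Set.univ)) (Set.mem_univ y) ne2
  have k1 : LocallyLipschitzOn Ω b1 := lipOn_locLip l1.lipschitzOnWith
  have k2 : LocallyLipschitzOn Ω b2 := lipOn_locLip l2.lipschitzOnWith
  have i0 : Integrable (fun p => φ p * f p) (volume.restrict Ω) :=
    lip_integ hΩ (locLip_mul hφl hf) (cs_mul φc) (ts_mul φt)
  have ip : ∀ e, Integrable (fun p => pdv e φ p * f p) (volume.restrict Ω) := by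
    intro e
    have q1 : ContDiff ℝ (⊤ : ℕ∞) (pdv e φ) :=
      (φs.fderiv_right (m := (⊤ : ℕ∞)) (by simp)).clm_apply contDiff_const
    have sub : tsupport (pdv e φ) ⊆ tsupport φ := by
      refine closure_minimal (fun p hp => ?_) (isClosed_tsupport _)
      by_contra h
      exact hp (pdv_zero_of_notMem h)
    have q2 : HasCompactSupport (pdv e φ) := φc.of_isClosed_subset (isClosed_tsupport _) sub
    have q3 : tsupport (pdv e φ) ⊆ Ω := sub.trans φt
    exact lip_integ hΩ (locLip_mul (smooth_locLip q1) hf) (cs_mul q2) (ts_mul q3)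
  have aef := ae_diff hΩ hf
  have ae1 := ae_diff hΩ k1
  have ae2 := ae_diff hΩ k2
  have iL : ∀ e : ℝ × ℝ, ‖e‖ ≤ 1 → Integrable (fun p => φ p * pdv e f p) (volume.restrict Ω) := by
    intro e he
    have w := integ_fsub (integ_pdv hΩ hb (locLip_mul hφl hf) (cs_mul φc) (ts_mul φt) he) (ip e)
    refine w.congr ?_
    filter_upwards [aef] with p hp
    rw [pdv_mul (φs.differentiable (by simp) p) hp]
    ring
  have iA : Integrable (fun p => (b1 p * pdv (1, 0) f p + b2 p * pdv (0, 1) f p) * φ p)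
      (volume.restrict Ω) := by
    refine ((integ_bmul m1 B1 (iL _ ne1)).add (integ_bmul m2 B2 (iL _ ne2))).congr
      (Eventually.of_forall fun p => ?_)
    simp only [Pi.add_apply]; ring
  have iB : Integrable (fun p => f p * ((b1 p * pdv (1, 0) φ p + b2 p * pdv (0, 1) φ p) +
        (pdv (1, 0) b1 p + pdv (0, 1) b2 p) * φ p)) (volume.restrict Ω) := by
    refine (((integ_bmul m1 B1 (ip (1, 0))).add (integ_bmul m2 B2 (ip (0, 1)))).add
      ((integ_bmul (pdv_meas _ _) d1 i0).add (integ_bmul (pdv_meas _ _) d2 i0))).congr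
      (Eventually.of_forall fun p => ?_)
    simp only [Pi.add_apply]; ring
  rw [eq_neg_iff_add_eq_zero, ← integral_add iA iB]
  refine Eq.trans ?_ (div_form hΩ hb hφl φc φt (locLip_mul k1 hf) (locLip_mul k2 hf))
  apply integral_congr_ae
  filter_upwards [aef, ae1, ae2] with p hp h1 h2
  rw [pdv_mul h1 hp, pdv_mul h2 hp]
  ring

lemma X_zero {Ω : Set (ℝ × ℝ)} (hΩ : IsOpen Ω) (hb : Bornology.IsBounded Ω)
    {b1 b2 g : ℝ × ℝ → ℝ} {C : NNReal} (l1 : LipschitzWith C b1) (l2 : LipschitzWith C b2)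
    (B1 : ∀ y, |b1 y| ≤ C) (B2 : ∀ y, |b2 y| ≤ C) (hg : LocallyLipschitzOn Ω g)
    (hw : ∀ φ, IsTest Ω φ → ∫ p in Ω, Fn (g p) *
      ((b1 p * pdv (1, 0) φ p + b2 p * pdv (0, 1) φ p) +
      (pdv (1, 0) b1 p + pdv (0, 1) b2 p) * φ p) = 0) :
    ∀ φ, IsTest Ω φ → ∫ p in Ω, g p *
      ((b1 p * pdv (1, 0) φ p + b2 p * pdv (0, 1) φ p) +
      (pdv (1, 0) b1 p + pdv (0, 1) b2 p) * φ p) = 0 := by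
  have hF : LocallyLipschitzOn Ω (fun p => Fn (g p)) := by
    intro x hx
    obtain ⟨K, t, ht, hK⟩ := hg hx
    exact ⟨1 * K, t, ht, Fn_lip.comp_lipschitzOnWith hK⟩
  set F := fun p => Fn (g p) with hFd
  have mX : Measurable fun p => b1 p * pdv (1, 0) F p + b2 p * pdv (0, 1) F p :=
    (l1.continuous.measurable.mul (pdv_meas _ _)).add (l2.continuous.measurable.mul (pdv_meas _ _))
  have li : LocallyIntegrableOn (fun p => b1 p * pdv (1, 0) F p + b2 p * pdv (0, 1) F p) Ω := by
    intro x hx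
    obtain ⟨K, t, ht, hK⟩ := hF hx
    rw [hΩ.nhdsWithin_eq hx] at ht
    obtain ⟨r, hr, hrt⟩ := Metric.mem_nhds_iff.1 ht
    refine ⟨Metric.ball x r, nhdsWithin_le_nhds (Metric.ball_mem_nhds x hr), ?_⟩
    refine integ_of_bdd Metric.isOpen_ball Metric.isBounded_ball mX.aestronglyMeasurable
      (C * K + C * K) fun p hp => ?_
    refine (abs_add_le _ _).trans ?_
    rw [abs_mul, abs_mul]
    gcongr
    · exact B1 p
    · exact pdv_bound Metric.isOpen_ball (hK.mono hrt) hp ne1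
    · exact B2 p
    · exact pdv_bound Metric.isOpen_ball (hK.mono hrt) hp ne2
  have z := hΩ.ae_eq_zero_of_integral_contDiff_smul_eq_zero li (fun φ φs φc φt => by
    have hφ : IsTest Ω φ := ⟨φs, φc, φt⟩
    have w := wk hΩ hb l1 l2 B1 B2 hF hφ
    rw [hw φ hφ, neg_zero, setIntegral_eq_integral_of_forall_compl_eq_zero] at w
    · refine Eq.trans ?_ w
      congr 1; ext p
      rw [smul_eq_mul, mul_comm]
    · intro p hp
      rw [image_eq_zero_of_notMem_tsupport fun h => hp (φt h), mul_zero])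
  intro φ hφ
  have w := wk hΩ hb l1 l2 B1 B2 hg hφ
  rw [← neg_eq_zero, ← w]
  rw [integral_congr_ae (g := fun _ => (0 : ℝ)), integral_zero]
  have z' := (ae_restrict_iff' hΩ.measurableSet).2 z
  filter_upwards [z', ae_diff hΩ hg] with p hp hd
  have ch : ∀ e, pdv e F p = 1 / (√(1 + g p ^ 2) * (1 + g p ^ 2)) * pdv e g p := by
    intro e
    have := (Fn_deriv (g p)).comp_hasFDerivAt p hd.hasFDerivAt
    have e2 := this.fderiv
    simp only [pdv]
    rw [show F = Fn ∘ g from rfl, e2]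
    simp
  rw [ch, ch] at hp
  have pos : 0 < 1 / (√(1 + g p ^ 2) * (1 + g p ^ 2)) := by
    have : 0 < 1 + g p ^ 2 := by positivity
    positivity
  have : b1 p * pdv (1, 0) g p + b2 p * pdv (0, 1) g p = 0 := by
    have h3 : (1 / (√(1 + g p ^ 2) * (1 + g p ^ 2))) *
        (b1 p * pdv (1, 0) g p + b2 p * pdv (0, 1) g p) = 0 := by
      have hp' := hp
      generalize 1 / (√(1 + g p ^ 2) * (1 + g p ^ 2)) = κ at hp' ⊢
      linear_combination hp'
    exact (mul_eq_zero.1 h3).resolve_left pos.ne'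
  rw [this, zero_mul]

lemma holder_of_locLip {Ω K : Set (ℝ × ℝ)} {f : ℝ × ℝ → ℝ} (hf : LocallyLipschitzOn Ω f)
    (hK : K ⊆ Ω) (hc : IsCompact K) {α : ℝ} (h0 : 0 < α) (h1 : α < 1) :
    ∃ C : ℝ, ∀ p ∈ K, ∀ q ∈ K, |f p - f q| ≤ C * dist p q ^ α := by
  obtain ⟨L, hL⟩ := (hf.mono hK).exists_lipschitzOnWith_of_compact hc
  refine ⟨L * Metric.diam K ^ (1 - α), fun p hp q hq => ?_⟩
  have hd := Metric.dist_le_diam_of_mem hc.isBounded hp hq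
  calc |f p - f q| ≤ L * dist p q := hL.dist_le_mul p hp q hq
    _ = L * (dist p q ^ (1 - α) * dist p q ^ α) := by
        rw [← Real.rpow_add_of_nonneg dist_nonneg (by linarith) h0.le]; simp
    _ ≤ L * (Metric.diam K ^ (1 - α) * dist p q ^ α) := by
        gcongr
    _ = _ := by ring

theorem stmt_x (Ω : Set (ℝ × ℝ)) (hΩo : IsOpen Ω) (hΩb : Bornology.IsBounded Ω)
    (s11 s12 : ℝ × ℝ × ℝ → ℝ) (hs11 : ContDiff ℝ (⊤ : ℕ∞) s11) (hs12 : ContDiff ℝ (⊤ : ℕ∞) s12)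
    (u : ℝ × ℝ → ℝ) (huvv : IsVVSol s11 s12 Ω u) :
    ∀ k : ℕ, 1 ≤ k → ∀ α : ℝ, 0 < α → α < 1 → ∃ g : ℕ → ℝ × ℝ → ℝ, g 0 = u ∧
        (∀ j < k, ∀ φ, IsTest Ω φ → ∫ p in Ω, g (j + 1) p * φ p =
          -∫ p in Ω, g j p * (X1 s11 s12 u φ p + m1 s11 s12 u p * φ p)) ∧
        (∀ j ≤ k, ∀ K ⊆ Ω, IsCompact K → ∃ C : ℝ, ∀ p ∈ K, ∀ q ∈ K,
          |g j p - g j q| ≤ C * dist p q ^ α) := by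
  obtain ⟨C, ⟨hu, -⟩, ⟨c1, a1⟩, ⟨c2, a2⟩, hst⟩ := stage1 hΩo hΩb hs11 hs12 huvv
  obtain ⟨b1, l1, B1, e1⟩ := lip_ext c1 a1
  obtain ⟨b2, l2, B2, e2⟩ := lip_ext c2 a2
  have hX : ∀ f : ℝ × ℝ → ℝ, ∀ p ∈ Ω, X1 s11 s12 u f p =
      b1 p * pdv (1, 0) f p + b2 p * pdv (0, 1) f p := by
    intro f p hp
    rw [← e1 p hp, ← e2 p hp]; rfl
  have hm : ∀ p ∈ Ω, m1 s11 s12 u p = pdv (1, 0) b1 p + pdv (0, 1) b2 p := by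
    intro p hp
    have q1 : (fun q : ℝ × ℝ => s11 (q.1, q.2, u q)) =ᶠ[𝓝 p] b1 :=
      Filter.eventually_of_mem (hΩo.mem_nhds hp) e1
    have q2 : (fun q : ℝ × ℝ => s12 (q.1, q.2, u q)) =ᶠ[𝓝 p] b2 :=
      Filter.eventually_of_mem (hΩo.mem_nhds hp) e2
    simp only [pdv]
    rw [← q1.fderiv_eq, ← q2.fderiv_eq]; rfl
  have conv : ∀ f φ : ℝ × ℝ → ℝ, ∫ p in Ω, f p * (X1 s11 s12 u φ p + m1 s11 s12 u p * φ p) =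
      ∫ p in Ω, f p * ((b1 p * pdv (1, 0) φ p + b2 p * pdv (0, 1) φ p) +
        (pdv (1, 0) b1 p + pdv (0, 1) b2 p) * φ p) := by
    intro f φ
    refine setIntegral_congr_fun hΩo.measurableSet fun p hp => ?_
    simp only [hX φ p hp, hm p hp]
  have hw : ∀ φ, IsTest Ω φ → ∫ p in Ω, Fn (b1 p * pdv (1, 0) u p + b2 p * pdv (0, 1) u p) *
      ((b1 p * pdv (1, 0) φ p + b2 p * pdv (0, 1) φ p) +
      (pdv (1, 0) b1 p + pdv (0, 1) b2 p) * φ p) = 0 := by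
    intro φ hφ
    refine Eq.trans ?_ (hst φ hφ)
    refine setIntegral_congr_fun hΩo.measurableSet fun p hp => ?_
    simp only [hX φ p hp, hX u p hp, hm p hp]
  have hul : LocallyLipschitzOn Ω u := lipOn_locLip hu
  have hdr := ae_diff hΩo hul
  have hd := (ae_restrict_iff' hΩo.measurableSet).1 hdr
  obtain ⟨g1, hg1, hgv⟩ := glue hΩo hd fun p0 hp0 => stage2 hΩo hΩb l1 l2 B1 B2 hu hw hp0
  have hgae : ∀ᵐ p ∂volume.restrict Ω, g1 p = b1 p * pdv (1, 0) u p + b2 p * pdv (0, 1) u p := by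
    rw [ae_restrict_iff' hΩo.measurableSet]
    filter_upwards [hd] with p hp hpΩ
    exact hgv p hpΩ (hp hpΩ)
  have hz := X_zero hΩo hΩb l1 l2 B1 B2 hg1 (fun φ hφ => by
    refine Eq.trans ?_ (hw φ hφ)
    apply integral_congr_ae
    filter_upwards [hgae] with p hp
    rw [hp])
  intro k _ α h0 h1
  refine ⟨fun j => match j with
    | 0 => u
    | 1 => g1
    | _ => fun _ => 0, rfl, ?_, ?_⟩
  · intro j _ φ hφ
    rw [conv]
    match j with
    | 0 =>
      refine Eq.trans ?_ (wk hΩo hΩb l1 l2 B1 B2 hul hφ)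
      apply integral_congr_ae
      filter_upwards [hgae] with p hp
      simp only [zero_add, hp]
    | 1 =>
      have := hz φ hφ
      simp [this]
    | (n + 2) => simp
  · intro j _ K hK hKc
    match j with
    | 0 => exact holder_of_locLip hul hK hKc h0 h1
    | 1 => exact holder_of_locLip hg1 hK hKc h0 h1
    | (n + 2) => exact ⟨0, fun p _ q _ => by simp⟩

theorem stmt_0
    (Ω : Set (ℝ × ℝ)) (hΩo : IsOpen Ω) (hΩb : Bornology.IsBounded Ω)
    (s11 s12 : ℝ × ℝ × ℝ → ℝ) (hs11 : ContDiff ℝ (⊤ : ℕ∞) s11) (hs12 : ContDiff ℝ (⊤ : ℕ∞) s12)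
    (hrank : RankCond s11 s12)
    (u : ℝ × ℝ → ℝ) (lu : NNReal) (hulip : LipschitzOnWith lu u Ω)
    (huvv : IsVVSol s11 s12 Ω u) :
    ∀ k : ℕ, 1 ≤ k → ∀ α : ℝ, 0 < α → α < 1 →
      ∃ g : ℕ → ℝ × ℝ → ℝ, g 0 = u ∧
        (∀ j < k, ∀ φ : ℝ × ℝ → ℝ, IsTest Ω φ →
          ∫ p in Ω, g (j + 1) p * φ p =
            -∫ p in Ω, g j p * (X1 s11 s12 u φ p + m1 s11 s12 u p * φ p)) ∧
        (∀ j ≤ k, ∀ K ⊆ Ω, IsCompact K → ∃ C : ℝ, ∀ p ∈ K, ∀ q ∈ K,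
          |g j p - g j q| ≤ C * dist p q ^ α) := by
  exact stmt_x Ω hΩo hΩb s11 s12 hs11 hs12 u huvv

end
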